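/- Calabi-type differential inequality for Monge–Ampère solutions: if u solves the weighted Monge–Ampère equation and φ := (1/2)(u_{,p} ξ^p + v_q x^q), then the function σ := |u_{,ijk}|²_g satisfies Δ_φ σ ≥ (1/(2n)) σ² at every point of N. -/

import Mathlib

open scoped BigOperators
noncomputable section

namespace KRS

variable {n : ℕ}

/-- Partial derivative of `f` in the `i`-th coordinate direction. -/
def pd (i : Fin n) (f : (Fin n → ℝ) → ℝ) : (Fin n → ℝ) → ℝ :=
  fun x => fderiv ℝ f x (Pi.single i 1)

/-- The Hessian matrix `g(x)` of `u`, with entries `g_{ij} = ∂²u/∂x^i∂x^j`. -/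
def hessian (u : (Fin n → ℝ) → ℝ) (x : Fin n → ℝ) : Matrix (Fin n) (Fin n) ℝ :=
  Matrix.of fun i j => pd i (pd j u) x

/-- The inverse matrix `g(x)⁻¹`, with entries `g^{ij}`. -/
def ginv (u : (Fin n → ℝ) → ℝ) (x : Fin n → ℝ) : Matrix (Fin n) (Fin n) ℝ :=
  (hessian u x)⁻¹

/-- Third iterated partial derivative `u_{,ijk}`. -/
def d3 (u : (Fin n → ℝ) → ℝ) (i j k : Fin n) : (Fin n → ℝ) → ℝ :=
  pd i (pd j (pd k u))

/-- Fourth iterated partial derivative `u_{,ijkl}`. -/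
def d4 (u : (Fin n → ℝ) → ℝ) (i j k l : Fin n) : (Fin n → ℝ) → ℝ :=
  pd i (pd j (pd k (pd l u)))

/-- Christoffel symbols `Γ^k_{ij} = (1/2) g^{kl}(∂_i g_{jl} + ∂_j g_{il} − ∂_l g_{ij})`. -/
def Christoffel (u : (Fin n → ℝ) → ℝ) (k i j : Fin n) : (Fin n → ℝ) → ℝ :=
  fun x => (1/2) * ∑ l, ginv u x k l * (d3 u i j l x + d3 u j i l x - d3 u l i j x)

/-- Riemann curvature tensor
`Rm_{ijkl} = g_{is}(∂_k Γ^s_{lj} − ∂_l Γ^s_{kj} + Γ^s_{kp} Γ^p_{lj} − Γ^s_{lp} Γ^p_{kj})`. -/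
def Rm (u : (Fin n → ℝ) → ℝ) (i j k l : Fin n) : (Fin n → ℝ) → ℝ :=
  fun x => ∑ s, hessian u x i s *
    (pd k (Christoffel u s l j) x - pd l (Christoffel u s k j) x
      + ∑ p, Christoffel u s k p x * Christoffel u p l j x
      - ∑ p, Christoffel u s l p x * Christoffel u p k j x)

/-- Ricci tensor `Ric_{ij} = ∂_k Γ^k_{ij} − ∂_j Γ^k_{ik} + Γ^k_{kp} Γ^p_{ij} − Γ^k_{jp} Γ^p_{ik}`. -/
def Ricci (u : (Fin n → ℝ) → ℝ) (i j : Fin n) : (Fin n → ℝ) → ℝ :=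
  fun x => (∑ k, pd k (Christoffel u k i j) x) - (∑ k, pd j (Christoffel u k i k) x)
    + (∑ k, ∑ p, Christoffel u k k p x * Christoffel u p i j x)
    - (∑ k, ∑ p, Christoffel u k j p x * Christoffel u p i k x)

/-- Scalar curvature `s = g^{ij} Ric_{ij}`. -/
def scalarCurv (u : (Fin n → ℝ) → ℝ) : (Fin n → ℝ) → ℝ :=
  fun x => ∑ i, ∑ j, ginv u x i j * Ricci u i j x

/-- Covariant Hessian `(∇²φ)_{ij} = φ_{,ij} − Γ^k_{ij} φ_{,k}`. -/
def covHess (u φ : (Fin n → ℝ) → ℝ) (i j : Fin n) : (Fin n → ℝ) → ℝ :=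
  fun x => pd i (pd j φ) x - ∑ k, Christoffel u k i j x * pd k φ x

/-- Laplace–Beltrami operator `Δφ = g^{ij} (∇²φ)_{ij}`. -/
def laplacian (u φ : (Fin n → ℝ) → ℝ) : (Fin n → ℝ) → ℝ :=
  fun x => ∑ i, ∑ j, ginv u x i j * covHess u φ i j x

/-- Weighted (drift) Laplacian `Δ_φ F = ΔF − g^{ij} φ_{,i} F_{,j}`. -/
def driftLap (u φ F : (Fin n → ℝ) → ℝ) : (Fin n → ℝ) → ℝ :=
  fun x => laplacian u F x - ∑ i, ∑ j, ginv u x i j * pd i φ x * pd j F x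

/-- Bakry–Émery Ricci tensor `(Ric_φ)_{ij} = Ric_{ij} + (∇²φ)_{ij}`. -/
def ricciPhi (u φ : (Fin n → ℝ) → ℝ) (i j : Fin n) : (Fin n → ℝ) → ℝ :=
  fun x => Ricci u i j x + covHess u φ i j x

/-- Pointwise squared `g`-norm of the third derivative tensor:
`|u_{,ijk}|²_g = g^{ip} g^{jq} g^{kr} u_{,ijk} u_{,pqr}`. -/
def norm3 (u : (Fin n → ℝ) → ℝ) : (Fin n → ℝ) → ℝ :=
  fun x => ∑ i, ∑ j, ∑ k, ∑ p, ∑ q, ∑ r,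
    ginv u x i p * ginv u x j q * ginv u x k r * d3 u i j k x * d3 u p q r x

/-- The canonical weight function `φ = (1/2)(u_{,p} ξ^p + v_q x^q)`. -/
def weight (u : (Fin n → ℝ) → ℝ) (ξ v : Fin n → ℝ) : (Fin n → ℝ) → ℝ :=
  fun x => (1/2) * ((∑ p, pd p u x * ξ p) + ∑ q, v q * x q)

/-- `u` solves the weighted Monge–Ampère equation
`log det g(x) = −v_p x^p + u_{,q}(x) ξ^q + c` on `N`. -/
def MAeq (u : (Fin n → ℝ) → ℝ) (N : Set (Fin n → ℝ)) (v ξ : Fin n → ℝ) (c : ℝ) : Prop :=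
  ∀ x ∈ N, Real.log (hessian u x).det = -(∑ p, v p * x p) + (∑ q, pd q u x * ξ q) + c

/-- Covariant derivative of the third derivative tensor:
`(∇T)_{lijk} = u_{,ijkl} − Γ^s_{li} u_{,sjk} − Γ^s_{lj} u_{,isk} − Γ^s_{lk} u_{,ijs}`. -/
def covT (u : (Fin n → ℝ) → ℝ) (l i j k : Fin n) : (Fin n → ℝ) → ℝ :=
  fun x => d4 u i j k l x - (∑ s, Christoffel u s l i x * d3 u s j k x)
    - (∑ s, Christoffel u s l j x * d3 u i s k x)
    - (∑ s, Christoffel u s l k x * d3 u i j s x)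

/-- Completeness of the Hessian metric `g = D²u` on `N`: every C¹ curve
`γ : [0,1) → N` that eventually leaves every compact subset of `N`
has infinite `g`-length. -/
def HessComplete (u : (Fin n → ℝ) → ℝ) (N : Set (Fin n → ℝ)) : Prop :=
  ∀ γ : ℝ → (Fin n → ℝ),
    ContDiffOn ℝ 1 γ (Set.Ico (0:ℝ) 1) →
    (∀ t ∈ Set.Ico (0:ℝ) 1, γ t ∈ N) →
    (∀ K : Set (Fin n → ℝ), IsCompact K → K ⊆ N →
      ∃ tK ∈ Set.Ico (0:ℝ) 1, ∀ t ∈ Set.Ioo tK 1, γ t ∉ K) →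
    ∫⁻ t in Set.Ioo (0:ℝ) 1,
      ENNReal.ofReal (Real.sqrt (∑ i, ∑ j,
        hessian u (γ t) i j * deriv γ t i * deriv γ t j)) = ⊤


/-- Directional derivative of `f` along the constant vector field `w`. -/
def dd (w : Fin n → ℝ) (f : (Fin n → ℝ) → ℝ) : (Fin n → ℝ) → ℝ :=
  fun x => fderiv ℝ f x w

lemma pd_eq_dd (i : Fin n) : pd i = dd (n := n) (Pi.single i 1) := rfl

section Calculus

variable {N : Set (Fin n → ℝ)} {f g : (Fin n → ℝ) → ℝ} {x : Fin n → ℝ}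

/-- Smooth real functions on `N`. -/
abbrev Smooth (N : Set (Fin n → ℝ)) (f : (Fin n → ℝ) → ℝ) : Prop :=
  ContDiffOn ℝ (⊤ : ℕ∞) f N

lemma Smooth.contDiffAt (hf : Smooth N f) (hN : IsOpen N) (hx : x ∈ N) :
    ContDiffAt ℝ (⊤ : ℕ∞) f x :=
  ContDiffOn.contDiffAt hf (hN.mem_nhds hx)

lemma Smooth.differentiableAt (hf : Smooth N f) (hN : IsOpen N) (hx : x ∈ N) :
    DifferentiableAt ℝ f x :=
  (hf.contDiffAt hN hx).differentiableAt (by simp)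

lemma Smooth.dd (hf : Smooth N f) (hN : IsOpen N) (w : Fin n → ℝ) : Smooth N (dd w f) :=
  (ContDiffOn.fderiv_of_isOpen hf hN (by simp)).clm_apply contDiffOn_const

lemma Smooth.pd (hf : Smooth N f) (hN : IsOpen N) (i : Fin n) : Smooth N (pd i f) :=
  hf.dd hN _

lemma dd_congr (hN : IsOpen N) (h : Set.EqOn f g N) (hx : x ∈ N) (w : Fin n → ℝ) :
    dd w f x = dd w g x := by
  unfold dd
  rw [(h.eventuallyEq_of_mem (hN.mem_nhds hx)).fderiv_eq]

lemma dd_add (hN : IsOpen N) (hf : Smooth N f) (hg : Smooth N g) (hx : x ∈ N) (w : Fin n → ℝ) :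
    dd w (fun y => f y + g y) x = dd w f x + dd w g x := by
  unfold dd
  rw [fderiv_fun_add (hf.differentiableAt hN hx) (hg.differentiableAt hN hx)]
  rfl

lemma dd_mul (hN : IsOpen N) (hf : Smooth N f) (hg : Smooth N g) (hx : x ∈ N) (w : Fin n → ℝ) :
    dd w (fun y => f y * g y) x = f x * dd w g x + g x * dd w f x := by
  unfold dd
  rw [fderiv_fun_mul (hf.differentiableAt hN hx) (hg.differentiableAt hN hx)]
  rfl

lemma dd_neg (w : Fin n → ℝ) : dd w (fun y => -f y) x = -dd w f x := by
  unfold dd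
  rw [fderiv_fun_neg]
  rfl

lemma dd_const (a : ℝ) (w : Fin n → ℝ) : dd w (fun _ => a) x = 0 := by
  simp [dd]

lemma dd_const_mul (hN : IsOpen N) (a : ℝ) (hf : Smooth N f) (hx : x ∈ N) (w : Fin n → ℝ) :
    dd w (fun y => a * f y) x = a * dd w f x := by
  rw [dd_mul hN contDiffOn_const hf hx, dd_const]
  ring

lemma dd_sum {ι : Type*} {s : Finset ι} {F : ι → (Fin n → ℝ) → ℝ} (hN : IsOpen N)
    (hF : ∀ i, Smooth N (F i)) (hx : x ∈ N) (w : Fin n → ℝ) :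
    dd w (fun y => ∑ i ∈ s, F i y) x = ∑ i ∈ s, dd w (F i) x := by
  unfold dd
  rw [fderiv_fun_sum fun i _ => (hF i).differentiableAt hN hx]
  simp

lemma dd_linear {ι : Type*} (s : Finset ι) (a : ι → ℝ) (w : ι → Fin n → ℝ) :
    dd (∑ i ∈ s, a i • w i) f x = ∑ i ∈ s, a i * dd (w i) f x := by
  simp [dd, map_sum]

lemma dd_eq_sum_pd (w : Fin n → ℝ) : dd w f x = ∑ i, w i * pd i f x := by
  conv_lhs => rw [pi_eq_sum_univ' w]
  exact dd_linear _ _ _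

lemma dd_comm (hN : IsOpen N) (hf : Smooth N f) (hx : x ∈ N) (v w : Fin n → ℝ) :
    dd v (dd w f) x = dd w (dd v f) x := by
  have hs : IsSymmSndFDerivAt ℝ f x :=
    (hf.contDiffAt hN hx).isSymmSndFDerivAt (by
      rw [minSmoothness_of_isRCLikeNormedField]
      exact WithTop.coe_le_coe.2 le_top)
  have hd : DifferentiableAt ℝ (fderiv ℝ f) x :=
    (((hf.contDiffAt hN hx).fderiv_right (m := 1) (by norm_cast)).differentiableAt (by simp))
  have key : ∀ a b : Fin n → ℝ, dd a (dd b f) x = fderiv ℝ (fderiv ℝ f) x a b := by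
    intro a b
    unfold dd
    rw [fderiv_clm_apply hd (differentiableAt_const b)]
    simp
  rw [key, key, hs.eq]

lemma smooth_det {A : (Fin n → ℝ) → Matrix (Fin n) (Fin n) ℝ}
    (hA : ∀ i j, Smooth N fun y => A y i j) : Smooth N fun y => (A y).det := by
  simp only [Matrix.det_apply']
  exact ContDiffOn.sum fun σ _ => contDiffOn_const.mul (contDiffOn_prod fun i _ => hA _ _)

lemma smooth_inv {A : (Fin n → ℝ) → Matrix (Fin n) (Fin n) ℝ}
    (hA : ∀ i j, Smooth N fun y => A y i j) (hdet : ∀ y ∈ N, (A y).det ≠ 0) (i j : Fin n) :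
    Smooth N fun y => (A y)⁻¹ i j := by
  simp only [Matrix.inv_def, Matrix.smul_apply, Ring.inverse_eq_inv', smul_eq_mul,
    Matrix.adjugate_apply]
  refine ((smooth_det hA).inv hdet).mul (smooth_det fun a b => ?_)
  by_cases h : a = j
  · subst h
    simpa using contDiffOn_const
  · simpa [Matrix.updateRow_ne h] using hA a b

lemma dd_det (hN : IsOpen N) {A : (Fin n → ℝ) → Matrix (Fin n) (Fin n) ℝ}
    (hA : ∀ i j, Smooth N fun y => A y i j) (hx : x ∈ N) (w : Fin n → ℝ) :
    dd w (fun y => (A y).det) x =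
      ∑ i, ∑ j, (A x).adjugate i j * dd w (fun y => A y j i) x := by
  have h1 : ∀ i, ∑ j, (A x).adjugate i j * dd w (fun y => A y j i) x =
      ((A x).updateCol i fun j => dd w (fun y => A y j i) x).det := by
    intro i
    rw [← Matrix.cramer_apply, Matrix.cramer_eq_adjugate_mulVec]
    rfl
  simp only [h1, Matrix.det_apply']
  rw [dd_sum hN (fun σ => contDiffOn_const.mul (contDiffOn_prod fun i _ => hA _ _)) hx,
    Finset.sum_comm]
  refine Finset.sum_congr rfl fun σ _ => ?_
  rw [dd_const_mul hN _ (contDiffOn_prod fun i _ => hA _ _) hx, ← Finset.mul_sum]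
  congr 1
  unfold dd
  rw [(HasFDerivAt.finsetProd fun i _ =>
    ((hA (σ i) i).differentiableAt hN hx).hasFDerivAt).fderiv]
  simp only [sum_apply, smul_apply, smul_eq_mul]
  refine Finset.sum_congr rfl fun i _ => ?_
  rw [← Finset.mul_prod_erase _ _ (Finset.mem_univ i), mul_comm]
  congr 1
  · simp
  · refine Finset.prod_congr rfl fun j hj => ?_
    rw [Matrix.updateCol_ne (Finset.ne_of_mem_erase hj)]

lemma dd_log_det (hN : IsOpen N) {A : (Fin n → ℝ) → Matrix (Fin n) (Fin n) ℝ}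
    (hA : ∀ i j, Smooth N fun y => A y i j) (hx : x ∈ N) (hdet : (A x).det ≠ 0)
    (w : Fin n → ℝ) :
    dd w (fun y => Real.log (A y).det) x =
      ∑ i, ∑ j, (A x)⁻¹ i j * dd w (fun y => A y j i) x := by
  have h := dd_det hN hA hx w
  unfold dd at h ⊢
  rw [fderiv.log ((smooth_det hA).differentiableAt hN hx) hdet]
  simp only [smul_apply, h, smul_eq_mul, Finset.mul_sum, Matrix.inv_def,
    Matrix.smul_apply, Ring.inverse_eq_inv', mul_assoc]

/-- First derivative of the entries of an inverse matrix. -/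
lemma dd_inv (hN : IsOpen N) {A : (Fin n → ℝ) → Matrix (Fin n) (Fin n) ℝ}
    (hA : ∀ i j, Smooth N fun y => A y i j) (hdet : ∀ y ∈ N, (A y).det ≠ 0) (hx : x ∈ N)
    (w : Fin n → ℝ) (i j : Fin n) :
    dd w (fun y => (A y)⁻¹ i j) x =
      -∑ k, ∑ l, (A x)⁻¹ i k * dd w (fun y => A y k l) x * (A x)⁻¹ l j := by
  have hI := smooth_inv hA hdet
  set D : Matrix (Fin n) (Fin n) ℝ := Matrix.of fun a b => dd w (fun y => (A y)⁻¹ a b) x with hD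
  set E : Matrix (Fin n) (Fin n) ℝ := Matrix.of fun a b => dd w (fun y => A y a b) x with hE
  have hprod : D * A x + (A x)⁻¹ * E = 0 := by
    ext a b
    have h0 : dd w (fun y => ∑ k, (A y)⁻¹ a k * A y k b) x = 0 := by
      rw [dd_congr hN (g := fun _ => (1 : Matrix (Fin n) (Fin n) ℝ) a b) _ hx, dd_const]
      intro y hy
      have := congrFun (congrFun (Matrix.nonsing_inv_mul (A y) (hdet y hy).isUnit) a) b
      rwa [Matrix.mul_apply] at this
    rw [dd_sum hN (fun k => (hI a k).mul (hA k b)) hx] at h0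
    simp only [dd_mul hN (hI a _) (hA _ b) hx] at h0
    rw [Matrix.add_apply, Matrix.mul_apply, Matrix.mul_apply, ← Finset.sum_add_distrib,
      Matrix.zero_apply, ← h0]
    exact Finset.sum_congr rfl fun k _ => by simp [hD, hE]; ring
  have hDeq : D = -((A x)⁻¹ * E * (A x)⁻¹) := by
    have h1 : D * A x = -((A x)⁻¹ * E) := eq_neg_of_add_eq_zero_left hprod
    calc D = D * A x * (A x)⁻¹ := by
          rw [Matrix.mul_assoc, Matrix.mul_nonsing_inv _ (hdet x hx).isUnit, Matrix.mul_one]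
      _ = _ := by rw [h1, Matrix.neg_mul]
  have := congrFun (congrFun hDeq i) j
  rw [hD, Matrix.of_apply] at this
  rw [this, Matrix.neg_apply, Matrix.mul_apply, Finset.sum_comm]
  simp only [Matrix.mul_apply, Finset.sum_mul, hE, Matrix.of_apply]

end Calculus
section Frame

variable {N : Set (Fin n → ℝ)} {u f : (Fin n → ℝ) → ℝ} {x : Fin n → ℝ}

lemma dd_eq_fun_sum_pd (w : Fin n → ℝ) (f : (Fin n → ℝ) → ℝ) :
    dd w f = fun y => ∑ i, w i * pd i f y :=
  funext fun _ => dd_eq_sum_pd w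

lemma dd_dd_eq_sum (hN : IsOpen N) (hf : Smooth N f) (hx : x ∈ N) (w z : Fin n → ℝ) :
    dd w (dd z f) x = ∑ i, ∑ j, w i * z j * pd i (pd j f) x := by
  rw [dd_eq_sum_pd w]
  refine Finset.sum_congr rfl fun i _ => ?_
  rw [dd_eq_fun_sum_pd z, pd_eq_dd i,
    dd_sum hN (fun j => contDiffOn_const.mul (hf.pd hN _)) hx, Finset.mul_sum]
  refine Finset.sum_congr rfl fun j _ => ?_
  rw [dd_const_mul hN _ (hf.pd hN _) hx, mul_assoc]

lemma hessian_smooth (hN : IsOpen N) (hu : Smooth N u) (i j : Fin n) :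
    Smooth N fun y => hessian u y i j :=
  (hu.dd hN _).dd hN _

lemma hessian_symm (hN : IsOpen N) (hu : Smooth N u) (hx : x ∈ N) (i j : Fin n) :
    hessian u x i j = hessian u x j i :=
  dd_comm hN hu hx _ _

lemma ginv_symm (hN : IsOpen N) (hu : Smooth N u) (hx : x ∈ N) (i j : Fin n) :
    ginv u x i j = ginv u x j i := by
  have h : (hessian u x).transpose = hessian u x := by
    ext a b
    exact hessian_symm hN hu hx b a
  have := congrFun (congrFun (Matrix.transpose_nonsing_inv (hessian u x)) i) j
  rw [h] at this
  exact this.symm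

/-- The Hessian of `u` with respect to a constant frame. -/
def frameHessian (u : (Fin n → ℝ) → ℝ) (e : Matrix (Fin n) (Fin n) ℝ) (y : Fin n → ℝ) :
    Matrix (Fin n) (Fin n) ℝ :=
  Matrix.of fun a b => dd (e a) (dd (e b) u) y

lemma frameHessian_eq (hN : IsOpen N) (hu : Smooth N u) (hx : x ∈ N)
    (e : Matrix (Fin n) (Fin n) ℝ) :
    frameHessian u e x = e * hessian u x * e.transpose := by
  ext a b
  rw [frameHessian, Matrix.of_apply, dd_dd_eq_sum hN hu hx, Matrix.mul_apply, Finset.sum_comm]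
  refine Finset.sum_congr rfl fun j _ => ?_
  rw [Matrix.mul_apply, Finset.sum_mul]
  refine Finset.sum_congr rfl fun i _ => ?_
  simp only [hessian, Matrix.of_apply, Matrix.transpose_apply]
  ring

lemma ginv_eq_frame (hN : IsOpen N) (hu : Smooth N u) (hx : x ∈ N)
    {e : Matrix (Fin n) (Fin n) ℝ} (he : IsUnit e.det) :
    ginv u x = e.transpose * (frameHessian u e x)⁻¹ * e := by
  have he' : IsUnit e.transpose.det := by rwa [Matrix.det_transpose]
  rw [frameHessian_eq hN hu hx, Matrix.mul_inv_rev, Matrix.mul_inv_rev, ginv,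
    Matrix.mul_nonsing_inv_cancel_left _ _ he', Matrix.nonsing_inv_mul_cancel_right _ _ he]

/-- Contraction of a bilinear expression against a congruent matrix. -/
lemma contract_congr (e h : Matrix (Fin n) (Fin n) ℝ) (Z : Fin n → Fin n → ℝ) :
    ∑ i, ∑ p, (e.transpose * h * e) i p * Z i p =
      ∑ a, ∑ b, h a b * ∑ i, ∑ p, e a i * e b p * Z i p := by
  simp only [Matrix.mul_apply, Matrix.transpose_apply, Finset.sum_mul, Finset.mul_sum]
  simp only [← Fintype.sum_prod_type']
  refine Finset.sum_nbij' (fun t => (t.2.2.2, t.2.2.1, t.1, t.2.1))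
    (fun t => (t.2.2.1, t.2.2.2, t.2.1, t.1)) ?_ ?_ ?_ ?_ ?_ <;> simp
  intros
  ring

lemma contract_frame (hN : IsOpen N) (hu : Smooth N u) (hf : Smooth N f) (hx : x ∈ N)
    {e : Matrix (Fin n) (Fin n) ℝ} (he : IsUnit e.det) :
    ∑ i, ∑ j, ginv u x i j * pd i (pd j f) x =
      ∑ a, ∑ b, (frameHessian u e x)⁻¹ a b * dd (e a) (dd (e b) f) x := by
  rw [ginv_eq_frame hN hu hx he, contract_congr]
  simp only [dd_dd_eq_sum hN hf hx]

/-- Differentiated Monge–Ampère equation. -/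
lemma MAeq.dd_eq {v ξ : Fin n → ℝ} {c : ℝ} (hMA : MAeq u N v ξ c) (hN : IsOpen N)
    (hu : Smooth N u) (hpos : ∀ y ∈ N, (hessian u y).PosDef) (hx : x ∈ N) (w : Fin n → ℝ) :
    ∑ i, ∑ j, ginv u x i j * pd i (pd j (dd w u)) x =
      -(∑ p, v p * w p) + dd w (dd ξ u) x := by
  have h1 := dd_log_det hN (hessian_smooth hN hu) hx (hpos x hx).det_pos.ne' w
  have hl : Smooth N fun y => ∑ p, -v p * y p :=
    ContDiffOn.sum fun p _ => contDiffOn_const.mul (contDiff_apply ℝ ℝ p).contDiffOn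
  have h2 : dd w (fun y => Real.log (hessian u y).det) x =
      dd w (fun y => (∑ p, -v p * y p) + (dd ξ u y + c)) x := by
    refine dd_congr hN (fun y hy => ?_) hx w
    simp only [hMA y hy, dd_eq_sum_pd ξ, neg_mul, Finset.sum_neg_distrib, mul_comm (ξ _),
      add_assoc]
  have hcoord : ∀ p, dd w (fun y : Fin n → ℝ => y p) x = w p := by
    intro p
    have : HasFDerivAt (fun y : Fin n → ℝ => y p) (ContinuousLinearMap.proj (R := ℝ) p) x :=
      hasFDerivAt_apply p x
    unfold dd
    rw [this.fderiv]
    rfl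
  rw [dd_add hN hl ((hu.dd hN ξ).add contDiffOn_const) hx,
    dd_add hN (hu.dd hN ξ) contDiffOn_const hx, dd_const, add_zero,
    dd_sum hN (fun p => contDiffOn_const.mul (contDiff_apply ℝ ℝ p).contDiffOn) hx] at h2
  have h3 : ∀ p, dd w (fun y : Fin n → ℝ => -v p * y p) x = -(v p * w p) := by
    intro p
    rw [dd_const_mul hN _ (contDiff_apply ℝ ℝ p).contDiffOn hx, hcoord]
    ring
  simp only [h3, Finset.sum_neg_distrib] at h2
  rw [← h2, h1]
  refine Finset.sum_congr rfl fun i _ => Finset.sum_congr rfl fun j _ => ?_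
  rw [show (hessian u x)⁻¹ = ginv u x from rfl]
  congr 1
  have hc : ∀ y ∈ N, pd j (dd w u) y = dd w (pd j u) y := fun y hy => dd_comm hN hu hy _ _
  rw [pd_eq_dd i, dd_congr hN hc hx, dd_comm hN (hu.pd hN _) hx]
  refine dd_congr hN (fun y hy => ?_) hx w
  exact (hessian_symm hN hu hy j i).symm

lemma dd_coord (p : Fin n) (w : Fin n → ℝ) : dd w (fun y : Fin n → ℝ => y p) x = w p := by
  have : HasFDerivAt (fun y : Fin n → ℝ => y p) (ContinuousLinearMap.proj (R := ℝ) p) x :=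
    hasFDerivAt_apply p x
  unfold dd
  rw [this.fderiv]
  rfl

lemma d3_symm_right (hN : IsOpen N) (hu : Smooth N u) (hx : x ∈ N) (i j k : Fin n) :
    d3 u i j k x = d3 u i k j x :=
  dd_congr hN (fun _ hy => dd_comm hN hu hy _ _) hx _

lemma d3_symm_left (hN : IsOpen N) (hu : Smooth N u) (hx : x ∈ N) (i j k : Fin n) :
    d3 u i j k x = d3 u j i k x :=
  dd_comm hN (hu.dd hN _) hx _ _

/-- On solutions, the drift Laplacian has constant first-order coefficients. -/
lemma driftLap_weight_eq {v ξ : Fin n → ℝ} {c : ℝ} (hMA : MAeq u N v ξ c) (hN : IsOpen N)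
    (hu : Smooth N u) (hpos : ∀ y ∈ N, (hessian u y).PosDef) (hx : x ∈ N)
    (F : (Fin n → ℝ) → ℝ) :
    driftLap u (weight u ξ v) F x =
      ∑ i, ∑ j, ginv u x i j * pd i (pd j F) x - dd ξ F x := by
  have hT : ∀ k i j, Christoffel u k i j x = (1/2) * ∑ l, ginv u x k l * d3 u i j l x := by
    intro k i j
    unfold Christoffel
    congr 1
    refine Finset.sum_congr rfl fun l _ => ?_
    rw [d3_symm_left hN hu hx j i l, d3_symm_left hN hu hx l i j, d3_symm_right hN hu hx i l j]
    ring
  have hw : ∀ i, pd i (weight u ξ v) x = (1/2) * (pd i (dd ξ u) x + v i) := by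
    intro i
    have hfun : weight u ξ v = fun y => (1/2) * (dd ξ u y + ∑ q, v q * y q) := by
      funext y
      simp only [weight, dd_eq_sum_pd ξ, mul_comm (ξ _)]
    have hs : ∀ q, Smooth N fun y => v q * y q := fun q =>
      contDiffOn_const.mul (contDiff_apply ℝ ℝ q).contDiffOn
    rw [hfun, pd_eq_dd, dd_const_mul hN _ ((hu.dd hN ξ).add (ContDiffOn.sum fun q _ => hs q)) hx,
      dd_add hN (hu.dd hN ξ) (ContDiffOn.sum fun q _ => hs q) hx, dd_sum hN hs hx]
    simp only [dd_const_mul hN _ (contDiff_apply ℝ ℝ _).contDiffOn hx, dd_coord]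
    simp [Pi.single_apply]
  have htr : ∀ l, ∑ i, ∑ j, ginv u x i j * d3 u i j l x = -v l + pd l (dd ξ u) x := by
    intro l
    have := hMA.dd_eq hN hu hpos hx (Pi.single l 1)
    simp only [Pi.single_apply, mul_ite, mul_one, mul_zero, Finset.sum_ite_eq',
      Finset.mem_univ, if_true] at this
    exact this
  have hξ : ∀ k, ∑ l, ginv u x k l * pd l (dd ξ u) x = ξ k := by
    intro k
    have h1 : ∀ l, pd l (dd ξ u) x = (hessian u x).mulVec ξ l := by
      intro l
      rw [dd_eq_fun_sum_pd ξ, pd_eq_dd, dd_sum hN (fun j => contDiffOn_const.mul (hu.pd hN _)) hx]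
      refine Finset.sum_congr rfl fun j _ => ?_
      rw [dd_const_mul hN _ (hu.pd hN _) hx, mul_comm]
      rfl
    have h2 : (ginv u x).mulVec ((hessian u x).mulVec ξ) = ξ := by
      rw [Matrix.mulVec_mulVec, ginv, Matrix.nonsing_inv_mul _ (hpos x hx).det_pos.ne'.isUnit,
        Matrix.one_mulVec]
    simp only [h1]
    exact congrFun h2 k
  have hA : ∑ i, ∑ j, ginv u x i j * ∑ k, Christoffel u k i j x * pd k F x =
      ∑ k, (1/2) * (∑ l, ginv u x k l * (-v l + pd l (dd ξ u) x)) * pd k F x := by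
    simp only [hT, ← htr, Finset.sum_mul, Finset.mul_sum]
    simp only [← Fintype.sum_prod_type']
    refine Finset.sum_nbij' (fun t => (t.2.2.1, t.2.2.2, t.1, t.2.1))
      (fun t => (t.2.2.1, t.2.2.2, t.1, t.2.1)) ?_ ?_ ?_ ?_ ?_ <;> simp
    intros
    ring
  have hB : ∑ i, ∑ j, ginv u x i j * pd i (weight u ξ v) x * pd j F x =
      ∑ k, (1/2) * (∑ l, ginv u x k l * (v l + pd l (dd ξ u) x)) * pd k F x := by
    rw [Finset.sum_comm]
    refine Finset.sum_congr rfl fun k _ => ?_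
    rw [Finset.mul_sum, Finset.sum_mul]
    refine Finset.sum_congr rfl fun l _ => ?_
    rw [hw, ginv_symm hN hu hx l k]
    ring
  have hC : dd ξ F x = ∑ k, (1/2) * (∑ l, ginv u x k l * (-v l + pd l (dd ξ u) x)) * pd k F x +
      ∑ k, (1/2) * (∑ l, ginv u x k l * (v l + pd l (dd ξ u) x)) * pd k F x := by
    rw [dd_eq_sum_pd, ← Finset.sum_add_distrib]
    refine Finset.sum_congr rfl fun k _ => ?_
    conv_lhs => rw [← hξ k]
    rw [← add_mul, ← mul_add, ← Finset.sum_add_distrib, Finset.mul_sum]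
    congr 1
    refine Finset.sum_congr rfl fun l _ => ?_
    ring
  unfold driftLap laplacian covHess
  simp only [mul_sub, Finset.sum_sub_distrib]
  rw [hA, hB, hC]
  ring

/-- Squared norm of a 3-tensor with respect to the symmetric form `h`. -/
def contract3 (h : Matrix (Fin n) (Fin n) ℝ) (T : Fin n → Fin n → Fin n → ℝ) : ℝ :=
  ∑ i, ∑ j, ∑ k, ∑ p, ∑ q, ∑ r, h i p * h j q * h k r * T i j k * T p q r

lemma contract3_eq_nested (h : Matrix (Fin n) (Fin n) ℝ) (T : Fin n → Fin n → Fin n → ℝ) :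
    contract3 h T =
      ∑ i, ∑ p, h i p * ∑ j, ∑ q, h j q * ∑ k, ∑ r, h k r * (T i j k * T p q r) := by
  simp only [contract3, Finset.mul_sum]
  simp only [← Fintype.sum_prod_type']
  refine Finset.sum_nbij'
    (fun t => (t.1, t.2.2.2.1, t.2.1, t.2.2.2.2.1, t.2.2.1, t.2.2.2.2.2))
    (fun t => (t.1, t.2.2.1, t.2.2.2.2.1, t.2.1, t.2.2.2.1, t.2.2.2.2.2))
    ?_ ?_ ?_ ?_ ?_ <;> simp
  intros
  ring

lemma sum_pair_comm (A B : Matrix (Fin n) (Fin n) ℝ) (Z : Fin n → Fin n → Fin n → Fin n → ℝ) :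
    ∑ j, ∑ q, A j q * ∑ c, ∑ d, B c d * Z j q c d =
      ∑ c, ∑ d, B c d * ∑ j, ∑ q, A j q * Z j q c d := by
  simp only [Finset.mul_sum]
  simp only [← Fintype.sum_prod_type']
  refine Finset.sum_nbij' (fun t => (t.2.2.1, t.2.2.2, t.1, t.2.1))
    (fun t => (t.2.2.1, t.2.2.2, t.1, t.2.1)) ?_ ?_ ?_ ?_ ?_ <;> simp
  intros
  ring

lemma sum_triple_reverse (h : Matrix (Fin n) (Fin n) ℝ)
    (Z : Fin n → Fin n → Fin n → Fin n → Fin n → Fin n → ℝ) :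
    ∑ c, ∑ d, h c d * ∑ a, ∑ b, h a b * ∑ i, ∑ p, h i p * Z i p a b c d =
      ∑ i, ∑ p, h i p * ∑ a, ∑ b, h a b * ∑ c, ∑ d, h c d * Z i p a b c d := by
  simp only [Finset.mul_sum]
  simp only [← Fintype.sum_prod_type']
  refine Finset.sum_nbij'
    (fun t => (t.2.2.2.2.1, t.2.2.2.2.2, t.2.2.1, t.2.2.2.1, t.1, t.2.1))
    (fun t => (t.2.2.2.2.1, t.2.2.2.2.2, t.2.2.1, t.2.2.2.1, t.1, t.2.1))
    ?_ ?_ ?_ ?_ ?_ <;> simp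
  intros
  ring

lemma contract_congr_mul (e h : Matrix (Fin n) (Fin n) ℝ) (X Y : Fin n → ℝ) :
    ∑ i, ∑ p, (e.transpose * h * e) i p * (X i * Y p) =
      ∑ a, ∑ b, h a b * ((∑ i, e a i * X i) * ∑ p, e b p * Y p) := by
  rw [contract_congr]
  refine Finset.sum_congr rfl fun a _ => Finset.sum_congr rfl fun b _ => ?_
  rw [Finset.sum_mul_sum]
  congr 1
  refine Finset.sum_congr rfl fun i _ => Finset.sum_congr rfl fun p _ => ?_
  ring

lemma contract3_congr (e h : Matrix (Fin n) (Fin n) ℝ) (T : Fin n → Fin n → Fin n → ℝ) :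
    contract3 (e.transpose * h * e) T =
      contract3 h fun a b c => ∑ i, e a i * ∑ j, e b j * ∑ k, e c k * T i j k := by
  simp only [contract3_eq_nested, contract_congr_mul]
  have h2 : ∀ i p, ∑ j, ∑ q, (e.transpose * h * e) j q *
      ∑ c, ∑ d, h c d * ((∑ k, e c k * T i j k) * ∑ r, e d r * T p q r) =
      ∑ c, ∑ d, h c d * ∑ a, ∑ b, h a b * ((∑ j, e a j * ∑ k, e c k * T i j k) *
        ∑ q, e b q * ∑ r, e d r * T p q r) := by
    intro i p
    rw [sum_pair_comm]
    simp only [contract_congr_mul]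
  simp only [h2]
  rw [sum_pair_comm]
  have h3 : ∀ c d, ∑ i, ∑ p, (e.transpose * h * e) i p *
      ∑ a, ∑ b, h a b * ((∑ j, e a j * ∑ k, e c k * T i j k) *
        ∑ q, e b q * ∑ r, e d r * T p q r) =
      ∑ a, ∑ b, h a b * ∑ a', ∑ b', h a' b' *
        ((∑ i, e a' i * ∑ j, e a j * ∑ k, e c k * T i j k) *
        ∑ p, e b' p * ∑ q, e b q * ∑ r, e d r * T p q r) := by
    intro c d
    rw [sum_pair_comm]
    simp only [contract_congr_mul]
  simp only [h3]
  exact sum_triple_reverse h _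

lemma norm3_eq_frame (hN : IsOpen N) (hu : Smooth N u) (hx : x ∈ N)
    {e : Matrix (Fin n) (Fin n) ℝ} (he : IsUnit e.det) :
    norm3 u x = contract3 (frameHessian u e x)⁻¹
      fun a b c => dd (e a) (dd (e b) (dd (e c) u)) x := by
  have h : norm3 u x = contract3 (ginv u x) fun i j k => d3 u i j k x := rfl
  rw [h, ginv_eq_frame hN hu hx he, contract3_congr]
  congr 1
  funext a b c
  rw [dd_eq_sum_pd (e a)]
  refine Finset.sum_congr rfl fun i _ => ?_
  congr 1
  rw [dd_eq_fun_sum_pd (e b), pd_eq_dd i,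
    dd_sum hN (fun j => contDiffOn_const.mul ((hu.dd hN _).pd hN _)) hx]
  refine Finset.sum_congr rfl fun j _ => ?_
  rw [dd_const_mul hN _ ((hu.dd hN _).pd hN _) hx, ← pd_eq_dd]
  congr 1
  rw [pd_eq_dd i, pd_eq_dd j, dd_eq_fun_sum_pd (e c),
    dd_congr hN (g := fun y => ∑ k, e c k * pd j (pd k u) y) _ hx]
  · rw [dd_sum hN (fun k => contDiffOn_const.mul ((hu.pd hN _).pd hN _)) hx]
    refine Finset.sum_congr rfl fun k _ => ?_
    rw [dd_const_mul hN _ ((hu.pd hN _).pd hN _) hx]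
    rfl
  · intro y hy
    rw [dd_sum hN (fun k => contDiffOn_const.mul (hu.pd hN _)) hy]
    refine Finset.sum_congr rfl fun k _ => ?_
    rw [dd_const_mul hN _ (hu.pd hN _) hy]
    rfl

end Frame
section Operator

variable {N : Set (Fin n → ℝ)} {f g : (Fin n → ℝ) → ℝ} {x : Fin n → ℝ}

/-- The constant-coefficient operator `∑ₐ e_a e_a − ξ`. -/
def frameOp (e : Matrix (Fin n) (Fin n) ℝ) (ξ : Fin n → ℝ) (f : (Fin n → ℝ) → ℝ)
    (x : Fin n → ℝ) : ℝ :=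
  ∑ a, dd (e a) (dd (e a) f) x - dd ξ f x

lemma dd_dd_sum {ι : Type*} {s : Finset ι} {F : ι → (Fin n → ℝ) → ℝ} (hN : IsOpen N)
    (hF : ∀ i, Smooth N (F i)) (hx : x ∈ N) (z w : Fin n → ℝ) :
    dd z (dd w fun y => ∑ i ∈ s, F i y) x = ∑ i ∈ s, dd z (dd w (F i)) x := by
  rw [dd_congr hN (fun y hy => dd_sum hN hF hy w) hx, dd_sum hN (fun i => (hF i).dd hN w) hx]

lemma dd_dd_mul (hN : IsOpen N) (hf : Smooth N f) (hg : Smooth N g) (hx : x ∈ N)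
    (z w : Fin n → ℝ) :
    dd z (dd w fun y => f y * g y) x =
      f x * dd z (dd w g) x + dd z f x * dd w g x + dd w f x * dd z g x
        + g x * dd z (dd w f) x := by
  rw [dd_congr hN (fun y hy => dd_mul hN hf hg hy w) hx,
    dd_add hN (hf.mul (hg.dd hN w)) (hg.mul (hf.dd hN w)) hx,
    dd_mul hN hf (hg.dd hN w) hx, dd_mul hN hg (hf.dd hN w) hx]
  ring

lemma frameOp_congr (hN : IsOpen N) (h : Set.EqOn f g N) (hx : x ∈ N)
    (e : Matrix (Fin n) (Fin n) ℝ) (ξ : Fin n → ℝ) : frameOp e ξ f x = frameOp e ξ g x := by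
  unfold frameOp
  rw [dd_congr hN h hx]
  congr 1
  exact Finset.sum_congr rfl fun a _ => dd_congr hN (fun y hy => dd_congr hN h hy _) hx _

lemma frameOp_sum {ι : Type*} {s : Finset ι} {F : ι → (Fin n → ℝ) → ℝ} (hN : IsOpen N)
    (hF : ∀ i, Smooth N (F i)) (hx : x ∈ N) (e : Matrix (Fin n) (Fin n) ℝ) (ξ : Fin n → ℝ) :
    frameOp e ξ (fun y => ∑ i ∈ s, F i y) x = ∑ i ∈ s, frameOp e ξ (F i) x := by
  unfold frameOp
  simp only [dd_dd_sum hN hF hx, dd_sum hN hF hx, Finset.sum_sub_distrib]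
  rw [Finset.sum_comm]

lemma frameOp_mul (hN : IsOpen N) (hf : Smooth N f) (hg : Smooth N g) (hx : x ∈ N)
    (e : Matrix (Fin n) (Fin n) ℝ) (ξ : Fin n → ℝ) :
    frameOp e ξ (fun y => f y * g y) x =
      f x * frameOp e ξ g x + g x * frameOp e ξ f x
        + 2 * ∑ a, dd (e a) f x * dd (e a) g x := by
  unfold frameOp
  simp only [dd_dd_mul hN hf hg hx, dd_mul hN hf hg hx, Finset.sum_add_distrib, ← Finset.mul_sum]
  ring

/-- Second derivatives of an inverse matrix at a point where it is the identity. -/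
lemma dd_dd_inv (hN : IsOpen N) {A : (Fin n → ℝ) → Matrix (Fin n) (Fin n) ℝ}
    (hA : ∀ i j, Smooth N fun y => A y i j) (hdet : ∀ y ∈ N, (A y).det ≠ 0) (hx : x ∈ N)
    (h1 : A x = 1) (z w : Fin n → ℝ) (i j : Fin n) :
    dd z (dd w fun y => (A y)⁻¹ i j) x =
      -dd z (dd w fun y => A y i j) x
      + ∑ k, (dd z (fun y => A y i k) x * dd w (fun y => A y k j) x
        + dd w (fun y => A y i k) x * dd z (fun y => A y k j) x) := by
  have hI := smooth_inv hA hdet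
  have hI1 : ∀ z a b, dd z (fun y => (A y)⁻¹ a b) x = -dd z (fun y => A y a b) x := by
    intro z a b
    rw [dd_inv hN hA hdet hx, h1]
    simp [Matrix.one_apply]
  rw [dd_congr hN (fun y hy => dd_inv hN hA hdet hy w i j) hx, dd_neg,
    dd_sum hN (fun k => ContDiffOn.sum fun l _ => ((hI i k).mul ((hA k l).dd hN w)).mul (hI l j))
      hx]
  have h2 : ∀ k, dd z (fun y => ∑ l, (A y)⁻¹ i k * dd w (fun y => A y k l) y * (A y)⁻¹ l j) x =
      ∑ l, ((A x)⁻¹ i k * dd w (fun y => A y k l) x * -dd z (fun y => A y l j) x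
        + (A x)⁻¹ l j * ((A x)⁻¹ i k * dd z (dd w fun y => A y k l) x
          + dd w (fun y => A y k l) x * -dd z (fun y => A y i k) x)) := by
    intro k
    rw [dd_sum hN (fun l => ((hI i k).mul ((hA k l).dd hN w)).mul (hI l j)) hx]
    refine Finset.sum_congr rfl fun l _ => ?_
    rw [dd_mul hN ((hI i k).mul ((hA k l).dd hN w)) (hI l j) hx,
      dd_mul hN (hI i k) ((hA k l).dd hN w) hx, hI1, hI1]
  simp only [h2, h1, inv_one, Matrix.one_apply, Finset.sum_add_distrib, mul_add]
  simp
  simp only [mul_comm]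
  ring

end Operator

section Trace

variable {N : Set (Fin n → ℝ)} {x : Fin n → ℝ} {h : (Fin n → ℝ) → Matrix (Fin n) (Fin n) ℝ}
  {W : Fin n → Fin n → (Fin n → ℝ) → ℝ}

lemma trace_value (h1 : h x = 1) : ∑ i, ∑ p, h x i p * W i p x = ∑ i, W i i x := by
  simp [h1, Matrix.one_apply]

lemma dd_trace (hN : IsOpen N) (hh : ∀ i p, Smooth N fun y => h y i p)
    (hW : ∀ i p, Smooth N (W i p)) (hx : x ∈ N) (h1 : h x = 1) (w : Fin n → ℝ) :
    dd w (fun y => ∑ i, ∑ p, h y i p * W i p y) x =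
      ∑ i, dd w (W i i) x + ∑ i, ∑ p, dd w (fun y => h y i p) x * W i p x := by
  rw [dd_sum hN (fun i => ContDiffOn.sum fun p _ => (hh i p).mul (hW i p)) hx,
    ← Finset.sum_add_distrib]
  refine Finset.sum_congr rfl fun i _ => ?_
  rw [dd_sum hN (fun p => (hh i p).mul (hW i p)) hx]
  simp only [dd_mul hN (hh i _) (hW i _) hx, Finset.sum_add_distrib, h1, Matrix.one_apply]
  simp [mul_comm]

lemma frameOp_trace (hN : IsOpen N) (hh : ∀ i p, Smooth N fun y => h y i p)
    (hW : ∀ i p, Smooth N (W i p)) (hx : x ∈ N) (h1 : h x = 1)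
    (e : Matrix (Fin n) (Fin n) ℝ) (ξ : Fin n → ℝ) :
    frameOp e ξ (fun y => ∑ i, ∑ p, h y i p * W i p y) x =
      ∑ i, frameOp e ξ (W i i) x + ∑ i, ∑ p, frameOp e ξ (fun y => h y i p) x * W i p x
        + 2 * ∑ a, ∑ i, ∑ p, dd (e a) (fun y => h y i p) x * dd (e a) (W i p) x := by
  rw [frameOp_sum hN (fun i => ContDiffOn.sum fun p _ => (hh i p).mul (hW i p)) hx,
    Finset.sum_comm (s := Finset.univ (α := Fin n)) (t := Finset.univ (α := Fin n))
      (f := fun a i => ∑ p, dd (e a) (fun y => h y i p) x * dd (e a) (W i p) x),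
    Finset.mul_sum, ← Finset.sum_add_distrib, ← Finset.sum_add_distrib]
  refine Finset.sum_congr rfl fun i _ => ?_
  rw [frameOp_sum hN (fun p => (hh i p).mul (hW i p)) hx, Finset.sum_comm, Finset.mul_sum]
  simp only [frameOp_mul hN (hh i _) (hW i _) hx, Finset.sum_add_distrib, h1, Matrix.one_apply]
  simp [mul_comm]

end Trace
section Tensors

variable {N : Set (Fin n → ℝ)} {u : (Fin n → ℝ) → ℝ} {x : Fin n → ℝ}
  {e : Matrix (Fin n) (Fin n) ℝ} {ξ : Fin n → ℝ} {K : (Fin n → ℝ) → ℝ}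

/-- Third derivatives of `u` in a constant frame. -/
def frameT (u : (Fin n → ℝ) → ℝ) (e : Matrix (Fin n) (Fin n) ℝ) (i j k : Fin n) :
    (Fin n → ℝ) → ℝ :=
  dd (e i) (dd (e j) (dd (e k) u))

/-- Fourth derivatives of `u` in a constant frame. -/
def frameQ (u : (Fin n → ℝ) → ℝ) (e : Matrix (Fin n) (Fin n) ℝ) (a i j k : Fin n) :
    (Fin n → ℝ) → ℝ :=
  dd (e a) (frameT u e i j k)

lemma frameT_smooth (hN : IsOpen N) (hu : Smooth N u) (i j k : Fin n) :
    Smooth N (frameT u e i j k) :=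
  ((hu.dd hN _).dd hN _).dd hN _

lemma frameHessian_smooth (hN : IsOpen N) (hu : Smooth N u) (i j : Fin n) :
    Smooth N fun y => frameHessian u e y i j :=
  (hu.dd hN _).dd hN _

lemma frameT_symm_left (hN : IsOpen N) (hu : Smooth N u) (hx : x ∈ N) (i j k : Fin n) :
    frameT u e i j k x = frameT u e j i k x :=
  dd_comm hN (hu.dd hN _) hx _ _

lemma frameT_symm_right (hN : IsOpen N) (hu : Smooth N u) (hx : x ∈ N) (i j k : Fin n) :
    frameT u e i j k x = frameT u e i k j x :=
  dd_congr hN (fun _ hy => dd_comm hN hu hy _ _) hx _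

lemma frameQ_symm_left (hN : IsOpen N) (hu : Smooth N u) (hx : x ∈ N) (a i j k : Fin n) :
    frameQ u e a i j k x = frameQ u e i a j k x :=
  dd_comm hN ((hu.dd hN _).dd hN _) hx _ _

lemma frameQ_symm_mid (hN : IsOpen N) (hu : Smooth N u) (hx : x ∈ N) (a i j k : Fin n) :
    frameQ u e a i j k x = frameQ u e a j i k x :=
  dd_congr hN (fun _ hy => frameT_symm_left hN hu hy _ _ _) hx _

lemma frameQ_symm_right (hN : IsOpen N) (hu : Smooth N u) (hx : x ∈ N) (a i j k : Fin n) :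
    frameQ u e a i j k x = frameQ u e a i k j x :=
  dd_congr hN (fun _ hy => frameT_symm_right hN hu hy _ _ _) hx _

lemma dd_frame_inv (hN : IsOpen N) (hu : Smooth N u)
    (hdet : ∀ y ∈ N, (frameHessian u e y).det ≠ 0) (hx : x ∈ N) (h1 : frameHessian u e x = 1)
    (w : Fin n → ℝ) (i j : Fin n) :
    dd w (fun y => (frameHessian u e y)⁻¹ i j) x = -dd w (fun y => frameHessian u e y i j) x := by
  rw [dd_inv hN (frameHessian_smooth hN hu) hdet hx, h1]
  simp [Matrix.one_apply]

lemma dd_frame_inv_eq (hN : IsOpen N) (hu : Smooth N u)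
    (hdet : ∀ y ∈ N, (frameHessian u e y).det ≠ 0) (hx : x ∈ N) (h1 : frameHessian u e x = 1)
    (a i j : Fin n) :
    dd (e a) (fun y => (frameHessian u e y)⁻¹ i j) x = -frameT u e a i j x :=
  dd_frame_inv hN hu hdet hx h1 _ _ _

lemma dd_dd_frame_inv_eq (hN : IsOpen N) (hu : Smooth N u)
    (hdet : ∀ y ∈ N, (frameHessian u e y).det ≠ 0) (hx : x ∈ N) (h1 : frameHessian u e x = 1)
    (a b i j : Fin n) :
    dd (e a) (dd (e b) (fun y => (frameHessian u e y)⁻¹ i j)) x =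
      -frameQ u e a b i j x + ∑ k, (frameT u e a i k x * frameT u e b k j x
        + frameT u e b i k x * frameT u e a k j x) :=
  dd_dd_inv hN (frameHessian_smooth hN hu) hdet hx h1 _ _ _ _

/-- First derivative of the traced third derivative equation. -/
lemma dd_trace_eq (hN : IsOpen N) (hu : Smooth N u)
    (hdet : ∀ y ∈ N, (frameHessian u e y).det ≠ 0)
    (hE : ∀ y ∈ N, ∀ w, ∑ a, ∑ b, (frameHessian u e y)⁻¹ a b * dd (e a) (dd (e b) (dd w u)) y =
      K w + dd w (dd ξ u) y) (hx : x ∈ N) (l k : Fin n) :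
    ∑ i, ∑ j, ((frameHessian u e x)⁻¹ i j * frameQ u e l i j k x
      + frameT u e i j k x * dd (e l) (fun y => (frameHessian u e y)⁻¹ i j) x) =
      dd ξ (fun y => frameHessian u e y l k) x := by
  have hI := smooth_inv (frameHessian_smooth (e := e) hN hu) hdet
  have h2 := dd_congr hN (fun y hy => hE y hy (e k)) hx (e l)
  rw [dd_add hN contDiffOn_const ((hu.dd hN _).dd hN _) hx, dd_const, zero_add] at h2
  have h3 : dd ξ (fun y => frameHessian u e y l k) x = dd (e l) (dd (e k) (dd ξ u)) x := by
    rw [dd_congr hN (f := dd (e k) (dd ξ u)) (fun y hy => dd_comm hN hu hy (e k) ξ) hx,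
      dd_comm hN (hu.dd hN _) hx]
    rfl
  rw [h3, ← h2]
  have h5 := dd_sum (s := Finset.univ) hN (fun i => ContDiffOn.sum (s := Finset.univ) fun j _ =>
    (hI i j).mul (frameT_smooth (e := e) hN hu i j k)) hx (e l)
  refine Eq.trans ?_ h5.symm
  refine Finset.sum_congr rfl fun i _ => ?_
  have h4 := dd_sum (s := Finset.univ) hN
    (fun j => (hI i j).mul (frameT_smooth (e := e) hN hu i j k)) hx (e l)
  refine Eq.trans ?_ h4.symm
  refine Finset.sum_congr rfl fun j _ => ?_
  exact (dd_mul hN (hI i j) (frameT_smooth (e := e) hN hu i j k) hx (e l)).symm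

lemma frameOp_frame_inv (hN : IsOpen N) (hu : Smooth N u)
    (hdet : ∀ y ∈ N, (frameHessian u e y).det ≠ 0)
    (hE : ∀ y ∈ N, ∀ w, ∑ a, ∑ b, (frameHessian u e y)⁻¹ a b * dd (e a) (dd (e b) (dd w u)) y =
      K w + dd w (dd ξ u) y) (hx : x ∈ N) (h1 : frameHessian u e x = 1) (i p : Fin n) :
    frameOp e ξ (fun y => (frameHessian u e y)⁻¹ i p) x =
      ∑ j, ∑ k, frameT u e i j k x * frameT u e p j k x := by
  unfold frameOp
  rw [dd_frame_inv hN hu hdet hx h1, ← dd_trace_eq hN hu hdet hE hx i p]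
  simp only [dd_dd_frame_inv_eq hN hu hdet hx h1, dd_frame_inv_eq hN hu hdet hx h1, h1, inv_one,
    Matrix.one_apply, Finset.sum_add_distrib]
  have hq : ∀ a, frameQ u e a a i p x = frameQ u e i a a p x := by
    intro a
    rw [frameQ_symm_mid hN hu hx, frameQ_symm_left hN hu hx]
  have ht : ∀ a k, frameT u e a i k x * frameT u e a k p x =
      frameT u e i a k x * frameT u e p a k x := by
    intro a k
    rw [frameT_symm_left hN hu hx a i k, frameT_symm_right hN hu hx a k p,
      frameT_symm_left hN hu hx a p k]
  have ht' : ∀ a k, frameT u e a k p x * -frameT u e i a k x =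
      -(frameT u e i a k x * frameT u e p a k x) := by
    intro a k
    rw [frameT_symm_right hN hu hx a k p, frameT_symm_left hN hu hx a p k]
    ring
  simp only [hq, ht, ht', Finset.sum_neg_distrib]
  simp
  ring

/-- Second derivative of the traced third derivative equation. -/
lemma frameOp_frameT (hN : IsOpen N) (hu : Smooth N u)
    (hdet : ∀ y ∈ N, (frameHessian u e y).det ≠ 0)
    (hE : ∀ y ∈ N, ∀ w, ∑ a, ∑ b, (frameHessian u e y)⁻¹ a b * dd (e a) (dd (e b) (dd w u)) y =
      K w + dd w (dd ξ u) y) (hx : x ∈ N) (h1 : frameHessian u e x = 1) (k l m : Fin n) :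
    frameOp e ξ (frameT u e k l m) x =
      ∑ i, ∑ j, (frameQ u e m l i j x * frameT u e i j k x
        + frameT u e l i j x * frameQ u e m i j k x + frameT u e m i j x * frameQ u e l i j k x)
      - ∑ i, ∑ j, ∑ s, (frameT u e m i s x * frameT u e l s j x
        + frameT u e l i s x * frameT u e m s j x) * frameT u e i j k x := by
  have hI := smooth_inv (frameHessian_smooth (e := e) hN hu) hdet
  have hQ : ∀ i j, Smooth N (frameQ u e l i j k) := fun i j => (frameT_smooth hN hu _ _ _).dd hN _
  have hT : ∀ i j, Smooth N (frameT u e i j k) := fun i j => frameT_smooth hN hu _ _ _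
  have hD : ∀ i j, Smooth N (dd (e l) fun y => (frameHessian u e y)⁻¹ i j) :=
    fun i j => (hI i j).dd hN _
  have h2 := dd_congr hN (fun y hy => dd_trace_eq hN hu hdet hE hy l k) hx (e m)
  rw [dd_sum hN (fun i => ContDiffOn.sum fun j _ =>
      ((hI i j).mul (hQ i j)).add ((hT i j).mul (hD i j))) hx] at h2
  have h3 : dd (e m) (dd ξ fun y => frameHessian u e y l k) x = dd ξ (frameT u e k l m) x := by
    rw [dd_comm hN (frameHessian_smooth hN hu _ _) hx]
    refine dd_congr hN (fun y hy => ?_) hx ξ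
    rw [frameT_symm_right hN hu hy, frameT_symm_left hN hu hy, frameT_symm_right hN hu hy]
    rfl
  have h4 : ∀ i, dd (e m) (fun y => ∑ j, ((frameHessian u e y)⁻¹ i j * frameQ u e l i j k y
      + frameT u e i j k y * dd (e l) (fun y => (frameHessian u e y)⁻¹ i j) y)) x =
      ∑ j, ((frameHessian u e x)⁻¹ i j * dd (e m) (frameQ u e l i j k) x
        - frameQ u e l i j k x * frameT u e m i j x
        + (frameT u e i j k x * (-frameQ u e m l i j x
          + ∑ s, (frameT u e m i s x * frameT u e l s j x
            + frameT u e l i s x * frameT u e m s j x))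
        - frameT u e l i j x * frameQ u e m i j k x)) := by
    intro i
    rw [dd_sum hN (fun j => ((hI i j).mul (hQ i j)).add ((hT i j).mul (hD i j))) hx]
    refine Finset.sum_congr rfl fun j _ => ?_
    rw [dd_add hN ((hI i j).mul (hQ i j)) ((hT i j).mul (hD i j)) hx,
      dd_mul hN (hI i j) (hQ i j) hx, dd_mul hN (hT i j) (hD i j) hx,
      dd_dd_frame_inv_eq hN hu hdet hx h1, dd_frame_inv_eq hN hu hdet hx h1,
      dd_frame_inv_eq hN hu hdet hx h1, show dd (e m) (frameT u e i j k) x =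
        frameQ u e m i j k x from rfl]
    ring
  rw [h3] at h2
  simp only [h4, h1, inv_one, Matrix.one_apply] at h2
  have h5 : ∀ a, dd (e a) (dd (e a) (frameT u e k l m)) x = dd (e m) (frameQ u e l a a k) x := by
    intro a
    have ha : ∀ y ∈ N, dd (e a) (frameT u e k l m) y = dd (e m) (frameT u e l a k) y := by
      intro y hy
      change frameQ u e a k l m y = frameQ u e m l a k y
      rw [frameQ_symm_right hN hu hy, frameQ_symm_mid hN hu hy, frameQ_symm_left hN hu hy,
        frameQ_symm_right hN hu hy, frameQ_symm_mid hN hu hy]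
    rw [dd_congr hN ha hx, dd_comm hN (frameT_smooth hN hu _ _ _) hx]
    refine dd_congr hN (fun y hy => ?_) hx _
    exact frameQ_symm_left hN hu hy _ _ _ _
  unfold frameOp
  simp only [h5]
  rw [← h2]
  simp only [Finset.sum_add_distrib, Finset.sum_sub_distrib, mul_add, Finset.mul_sum, add_mul]
  simp
  simp only [mul_comm]
  ring

end Tensors
section Algebra

variable {T : Fin n → Fin n → Fin n → ℝ} {Q : Fin n → Fin n → Fin n → Fin n → ℝ}

/-- Contraction `T_{ijk} T_{pjk}`. -/
def ricT (T : Fin n → Fin n → Fin n → ℝ) (i p : Fin n) : ℝ :=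
  ∑ j, ∑ k, T i j k * T p j k

/-- Contraction `T_{lip} T_{jkp}`. -/
def pairT (T : Fin n → Fin n → Fin n → ℝ) (l i j k : Fin n) : ℝ :=
  ∑ p, T l i p * T j k p

/-- The tetrahedral quartic contraction of `T`. -/
def tetraT (T : Fin n → Fin n → Fin n → ℝ) : ℝ :=
  ∑ l, ∑ i, ∑ j, ∑ k, ∑ p, ∑ r, T l i p * T j k p * (T l j r * T i k r)

/-- The contraction `Q_{lijk} T_{lip} T_{jkp}`. -/
def mixQT (Q : Fin n → Fin n → Fin n → Fin n → ℝ) (T : Fin n → Fin n → Fin n → ℝ) : ℝ :=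
  ∑ l, ∑ i, ∑ j, ∑ k, ∑ p, Q l i j k * (T l i p * T j k p)

/-- Derivative of `T_{ijk} g^{kr} T_{pqr}` in an orthonormal frame. -/
def deriv1T (T : Fin n → Fin n → Fin n → ℝ) (Q : Fin n → Fin n → Fin n → Fin n → ℝ)
    (a i p j q : Fin n) : ℝ :=
  ∑ k, (T i j k * Q a p q k + T p q k * Q a i j k)
    - ∑ k, ∑ r, T a k r * (T i j k * T p q r)

/-- Derivative of `T_{ijk} g^{jq} g^{kr} T_{pqr}` in an orthonormal frame. -/
def deriv2T (T : Fin n → Fin n → Fin n → ℝ) (Q : Fin n → Fin n → Fin n → Fin n → ℝ)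
    (a i p : Fin n) : ℝ :=
  ∑ j, deriv1T T Q a i p j j - ∑ j, ∑ q, T a j q * ∑ k, T i j k * T p q k

/-- Drift Laplacian of `T_{ijk} g^{kr} T_{pqr}` in an orthonormal frame, given that of `T`. -/
def lap1T (T : Fin n → Fin n → Fin n → ℝ) (Q : Fin n → Fin n → Fin n → Fin n → ℝ)
    (P : Fin n → Fin n → Fin n → ℝ) (i p j q : Fin n) : ℝ :=
  ∑ k, (T i j k * P p q k + T p q k * P i j k + 2 * ∑ a, Q a i j k * Q a p q k)
    + ∑ k, ∑ r, ricT T k r * (T i j k * T p q r)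
    - 2 * ∑ a, ∑ k, ∑ r, T a k r * (T i j k * Q a p q r + T p q r * Q a i j k)

/-- Drift Laplacian of `T_{ijk} g^{jq} g^{kr} T_{pqr}` in an orthonormal frame. -/
def lap2T (T : Fin n → Fin n → Fin n → ℝ) (Q : Fin n → Fin n → Fin n → Fin n → ℝ)
    (P : Fin n → Fin n → Fin n → ℝ) (i p : Fin n) : ℝ :=
  ∑ j, lap1T T Q P i p j j + ∑ j, ∑ q, ricT T j q * ∑ k, T i j k * T p q k
    - 2 * ∑ a, ∑ j, ∑ q, T a j q * deriv1T T Q a i p j q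

/-- Drift Laplacian of `|T|²` in an orthonormal frame. -/
def lap3T (T : Fin n → Fin n → Fin n → ℝ) (Q : Fin n → Fin n → Fin n → Fin n → ℝ)
    (P : Fin n → Fin n → Fin n → ℝ) : ℝ :=
  ∑ i, lap2T T Q P i i + ∑ i, ∑ p, ricT T i p * ricT T i p
    - 2 * ∑ a, ∑ i, ∑ p, T a i p * deriv2T T Q a i p

lemma tetraT_eq_deriv2_snd (hT₁ : ∀ i j k, T i j k = T j i k) (hT₂ : ∀ i j k, T i j k = T i k j) :
    ∑ a, ∑ i, ∑ p, T a i p * ∑ j, ∑ q, T a j q * ∑ k, T i j k * T p q k =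
      tetraT T := by
  unfold tetraT
  simp only [Finset.mul_sum]
  simp only [← Fintype.sum_prod_type']
  refine Finset.sum_nbij' (fun t => (t.1, t.2.1, t.2.2.2.2.1, t.2.2.2.2.2, t.2.2.1, t.2.2.2.1))
    (fun t => (t.1, t.2.1, t.2.2.2.2.1, t.2.2.2.2.2, t.2.2.1, t.2.2.2.1))
    (fun _ _ => Finset.mem_univ _) (fun _ _ => Finset.mem_univ _) (fun _ _ => rfl)
    (fun _ _ => rfl) ?_
  rintro ⟨a, i, p, j, q, k⟩ -
  simp only [hT₁, hT₂]
  ring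

lemma tetraT_eq_deriv2_fst (hT₁ : ∀ i j k, T i j k = T j i k) (hT₂ : ∀ i j k, T i j k = T i k j) :
    ∑ a, ∑ i, ∑ p, T a i p * ∑ j, ∑ k, ∑ r, T a k r * (T i j k * T p j r) =
      tetraT T := by
  unfold tetraT
  simp only [Finset.mul_sum]
  simp only [← Fintype.sum_prod_type']
  refine Finset.sum_nbij' (fun t => (t.1, t.2.1, t.2.2.2.2.2, t.2.2.2.1, t.2.2.1, t.2.2.2.2.1))
    (fun t => (t.1, t.2.1, t.2.2.2.2.1, t.2.2.2.1, t.2.2.2.2.2, t.2.2.1))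
    (fun _ _ => Finset.mem_univ _) (fun _ _ => Finset.mem_univ _) (fun _ _ => rfl)
    (fun _ _ => rfl) ?_
  rintro ⟨a, i, p, j, k, r⟩ -
  simp only [hT₁, hT₂]
  ring

lemma tetraT_eq_deriv1 (hT₁ : ∀ i j k, T i j k = T j i k) (hT₂ : ∀ i j k, T i j k = T i k j) :
    ∑ i, ∑ a, ∑ j, ∑ q, T a j q * ∑ k, ∑ r, T a k r * (T i j k * T i q r) =
      tetraT T := by
  unfold tetraT
  simp only [Finset.mul_sum]
  simp only [← Fintype.sum_prod_type']
  refine Finset.sum_nbij' (fun t => (t.2.1, t.2.2.1, t.2.2.2.2.2, t.1, t.2.2.2.1, t.2.2.2.2.1))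
    (fun t => (t.2.2.2.1, t.1, t.2.1, t.2.2.2.2.1, t.2.2.2.2.2, t.2.2.1))
    (fun _ _ => Finset.mem_univ _) (fun _ _ => Finset.mem_univ _) (fun _ _ => rfl)
    (fun _ _ => rfl) ?_
  rintro ⟨i, a, j, q, k, r⟩ -
  simp only [hT₁, hT₂]
  ring

lemma tetraT_eq_cubic_fst (hT₁ : ∀ i j k, T i j k = T j i k) (hT₂ : ∀ i j k, T i j k = T i k j) :
    ∑ k, ∑ l, ∑ m, T k l m * ∑ i, ∑ j, ∑ s, T m i s * T l s j * T i j k =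
      tetraT T := by
  unfold tetraT
  simp only [Finset.mul_sum]
  simp only [← Fintype.sum_prod_type']
  refine Finset.sum_nbij' (fun t => (t.1, t.2.1, t.2.2.2.1, t.2.2.2.2.2, t.2.2.1, t.2.2.2.2.1))
    (fun t => (t.1, t.2.1, t.2.2.2.2.1, t.2.2.1, t.2.2.2.2.2, t.2.2.2.1))
    (fun _ _ => Finset.mem_univ _) (fun _ _ => Finset.mem_univ _) (fun _ _ => rfl)
    (fun _ _ => rfl) ?_
  rintro ⟨k, l, m, i, j, s⟩ -
  simp only [hT₁, hT₂]
  ring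

lemma tetraT_eq_cubic_snd (hT₁ : ∀ i j k, T i j k = T j i k) (hT₂ : ∀ i j k, T i j k = T i k j) :
    ∑ k, ∑ l, ∑ m, T k l m * ∑ i, ∑ j, ∑ s, T l i s * T m s j * T i j k =
      tetraT T := by
  unfold tetraT
  simp only [Finset.mul_sum]
  simp only [← Fintype.sum_prod_type']
  refine Finset.sum_nbij' (fun t => (t.1, t.2.1, t.2.2.2.2.1, t.2.2.2.2.2, t.2.2.1, t.2.2.2.1))
    (fun t => (t.1, t.2.1, t.2.2.2.2.1, t.2.2.2.2.2, t.2.2.1, t.2.2.2.1))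
    (fun _ _ => Finset.mem_univ _) (fun _ _ => Finset.mem_univ _) (fun _ _ => rfl)
    (fun _ _ => rfl) ?_
  rintro ⟨k, l, m, i, j, s⟩ -
  simp only [hT₁, hT₂]
  ring

lemma mixQT_eq_lap1_fst (hT₂ : ∀ i j k, T i j k = T i k j)
    (hQ₁ : ∀ a i j k, Q a i j k = Q i a j k) (hQ₂ : ∀ a i j k, Q a i j k = Q a j i k)
    (hQ₃ : ∀ a i j k, Q a i j k = Q a i k j) :
    ∑ i, ∑ j, ∑ a, ∑ k, ∑ r, T a k r * (T i j k * Q a i j r) =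
      mixQT Q T := by
  unfold mixQT
  simp only [← Fintype.sum_prod_type']
  refine Finset.sum_nbij' (fun t => (t.2.2.1, t.2.2.2.2, t.1, t.2.1, t.2.2.2.1))
    (fun t => (t.2.2.1, t.2.2.2.1, t.1, t.2.2.2.2, t.2.1))
    (fun _ _ => Finset.mem_univ _) (fun _ _ => Finset.mem_univ _) (fun _ _ => rfl)
    (fun _ _ => rfl) ?_
  rintro ⟨i, j, a, k, r⟩ -
  simp only [hT₂, hQ₁, hQ₂, hQ₃]
  ring

lemma mixQT_eq_lap1_snd (hQ₁ : ∀ a i j k, Q a i j k = Q i a j k)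
    (hQ₂ : ∀ a i j k, Q a i j k = Q a j i k) (hQ₃ : ∀ a i j k, Q a i j k = Q a i k j) :
    ∑ i, ∑ j, ∑ a, ∑ k, ∑ r, T a k r * (T i j r * Q a i j k) =
      mixQT Q T := by
  unfold mixQT
  simp only [← Fintype.sum_prod_type']
  refine Finset.sum_nbij' (fun t => (t.2.2.1, t.2.2.2.1, t.1, t.2.1, t.2.2.2.2))
    (fun t => (t.2.2.1, t.2.2.2.1, t.1, t.2.1, t.2.2.2.2))
    (fun _ _ => Finset.mem_univ _) (fun _ _ => Finset.mem_univ _) (fun _ _ => rfl)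
    (fun _ _ => rfl) ?_
  rintro ⟨i, j, a, k, r⟩ -
  simp only [hQ₁, hQ₂, hQ₃]
  ring

lemma mixQT_eq_deriv1_fst (hT₂ : ∀ i j k, T i j k = T i k j)
    (hQ₁ : ∀ a i j k, Q a i j k = Q i a j k) (hQ₂ : ∀ a i j k, Q a i j k = Q a j i k) :
    ∑ i, ∑ a, ∑ j, ∑ q, T a j q * ∑ k, T i j k * Q a i q k =
      mixQT Q T := by
  unfold mixQT
  simp only [Finset.mul_sum]
  simp only [← Fintype.sum_prod_type']
  refine Finset.sum_nbij' (fun t => (t.2.1, t.2.2.2.1, t.1, t.2.2.2.2, t.2.2.1))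
    (fun t => (t.2.2.1, t.1, t.2.2.2.2, t.2.1, t.2.2.2.1))
    (fun _ _ => Finset.mem_univ _) (fun _ _ => Finset.mem_univ _) (fun _ _ => rfl)
    (fun _ _ => rfl) ?_
  rintro ⟨i, a, j, q, k⟩ -
  simp only [hT₂, hQ₁, hQ₂]
  ring

lemma mixQT_eq_deriv1_snd (hT₂ : ∀ i j k, T i j k = T i k j)
    (hQ₁ : ∀ a i j k, Q a i j k = Q i a j k) (hQ₂ : ∀ a i j k, Q a i j k = Q a j i k) :
    ∑ i, ∑ a, ∑ j, ∑ q, T a j q * ∑ k, T i q k * Q a i j k =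
      mixQT Q T := by
  unfold mixQT
  simp only [Finset.mul_sum]
  simp only [← Fintype.sum_prod_type']
  refine Finset.sum_nbij' (fun t => (t.2.1, t.2.2.1, t.1, t.2.2.2.2, t.2.2.2.1))
    (fun t => (t.2.2.1, t.1, t.2.1, t.2.2.2.2, t.2.2.2.1))
    (fun _ _ => Finset.mem_univ _) (fun _ _ => Finset.mem_univ _) (fun _ _ => rfl)
    (fun _ _ => rfl) ?_
  rintro ⟨i, a, j, q, k⟩ -
  simp only [hT₂, hQ₁, hQ₂]
  ring

lemma mixQT_eq_deriv2_fst (hT₁ : ∀ i j k, T i j k = T j i k) (hT₂ : ∀ i j k, T i j k = T i k j) :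
    ∑ a, ∑ i, ∑ p, T a i p * ∑ j, ∑ k, T i j k * Q a p j k =
      mixQT Q T := by
  unfold mixQT
  simp only [Finset.mul_sum]
  simp only [← Fintype.sum_prod_type']
  refine Finset.sum_nbij' (fun t => (t.1, t.2.2.1, t.2.2.2.1, t.2.2.2.2, t.2.1))
    (fun t => (t.1, t.2.2.2.2, t.2.1, t.2.2.1, t.2.2.2.1))
    (fun _ _ => Finset.mem_univ _) (fun _ _ => Finset.mem_univ _) (fun _ _ => rfl)
    (fun _ _ => rfl) ?_
  rintro ⟨a, i, p, j, k⟩ -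
  simp only [hT₁, hT₂]
  ring

lemma mixQT_eq_deriv2_snd (hT₁ : ∀ i j k, T i j k = T j i k) (hT₂ : ∀ i j k, T i j k = T i k j) :
    ∑ a, ∑ i, ∑ p, T a i p * ∑ j, ∑ k, T p j k * Q a i j k =
      mixQT Q T := by
  unfold mixQT
  simp only [Finset.mul_sum]
  simp only [← Fintype.sum_prod_type']
  refine Finset.sum_nbij' (fun t => (t.1, t.2.1, t.2.2.2.1, t.2.2.2.2, t.2.2.1))
    (fun t => (t.1, t.2.1, t.2.2.2.2, t.2.2.1, t.2.2.2.1))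
    (fun _ _ => Finset.mem_univ _) (fun _ _ => Finset.mem_univ _) (fun _ _ => rfl)
    (fun _ _ => rfl) ?_
  rintro ⟨a, i, p, j, k⟩ -
  simp only [hT₁, hT₂]
  ring

lemma mixQT_eq_cubic_fst (hT₁ : ∀ i j k, T i j k = T j i k) (hT₂ : ∀ i j k, T i j k = T i k j)
    (hQ₁ : ∀ a i j k, Q a i j k = Q i a j k) :
    ∑ k, ∑ l, ∑ m, T k l m * ∑ i, ∑ j, Q m l i j * T i j k =
      mixQT Q T := by
  unfold mixQT
  simp only [Finset.mul_sum]
  simp only [← Fintype.sum_prod_type']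
  refine Finset.sum_nbij' (fun t => (t.2.2.1, t.2.1, t.2.2.2.1, t.2.2.2.2, t.1))
    (fun t => (t.2.2.2.2, t.2.1, t.1, t.2.2.1, t.2.2.2.1))
    (fun _ _ => Finset.mem_univ _) (fun _ _ => Finset.mem_univ _) (fun _ _ => rfl)
    (fun _ _ => rfl) ?_
  rintro ⟨k, l, m, i, j⟩ -
  simp only [hT₁, hT₂, hQ₁]
  ring

lemma mixQT_eq_cubic_snd (hT₁ : ∀ i j k, T i j k = T j i k) (hT₂ : ∀ i j k, T i j k = T i k j)
    (hQ₁ : ∀ a i j k, Q a i j k = Q i a j k) (hQ₂ : ∀ a i j k, Q a i j k = Q a j i k)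
    (hQ₃ : ∀ a i j k, Q a i j k = Q a i k j) :
    ∑ k, ∑ l, ∑ m, T k l m * ∑ i, ∑ j, T l i j * Q m i j k =
      mixQT Q T := by
  unfold mixQT
  simp only [Finset.mul_sum]
  simp only [← Fintype.sum_prod_type']
  refine Finset.sum_nbij' (fun t => (t.2.2.1, t.1, t.2.2.2.1, t.2.2.2.2, t.2.1))
    (fun t => (t.2.1, t.2.2.2.2, t.1, t.2.2.1, t.2.2.2.1))
    (fun _ _ => Finset.mem_univ _) (fun _ _ => Finset.mem_univ _) (fun _ _ => rfl)
    (fun _ _ => rfl) ?_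
  rintro ⟨k, l, m, i, j⟩ -
  simp only [hT₁, hT₂, hQ₁, hQ₂, hQ₃]
  ring

lemma mixQT_eq_cubic_thd (hT₁ : ∀ i j k, T i j k = T j i k) (hT₂ : ∀ i j k, T i j k = T i k j)
    (hQ₁ : ∀ a i j k, Q a i j k = Q i a j k) (hQ₂ : ∀ a i j k, Q a i j k = Q a j i k)
    (hQ₃ : ∀ a i j k, Q a i j k = Q a i k j) :
    ∑ k, ∑ l, ∑ m, T k l m * ∑ i, ∑ j, T m i j * Q l i j k =
      mixQT Q T := by
  unfold mixQT
  simp only [Finset.mul_sum]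
  simp only [← Fintype.sum_prod_type']
  refine Finset.sum_nbij' (fun t => (t.2.1, t.1, t.2.2.2.1, t.2.2.2.2, t.2.2.1))
    (fun t => (t.2.1, t.1, t.2.2.2.2, t.2.2.1, t.2.2.2.1))
    (fun _ _ => Finset.mem_univ _) (fun _ _ => Finset.mem_univ _) (fun _ _ => rfl)
    (fun _ _ => rfl) ?_
  rintro ⟨k, l, m, i, j⟩ -
  simp only [hT₁, hT₂, hQ₁, hQ₂, hQ₃]
  ring

lemma sum_mul_ricT_left (R : Fin n → Fin n → ℝ) (hT₁ : ∀ i j k, T i j k = T j i k)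
    (hT₂ : ∀ i j k, T i j k = T i k j) :
    ∑ i, ∑ j, ∑ k, ∑ r, R k r * (T i j k * T i j r) =
      ∑ k, ∑ r, R k r * ricT T k r := by
  unfold ricT
  simp only [Finset.mul_sum]
  simp only [← Fintype.sum_prod_type']
  refine Finset.sum_nbij' (fun t => (t.2.2.1, t.2.2.2, t.1, t.2.1))
    (fun t => (t.2.2.1, t.2.2.2, t.1, t.2.1))
    (fun _ _ => Finset.mem_univ _) (fun _ _ => Finset.mem_univ _) (fun _ _ => rfl)
    (fun _ _ => rfl) ?_
  rintro ⟨i, j, k, r⟩ -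
  simp only [hT₁, hT₂]

lemma sum_mul_ricT_mid (R : Fin n → Fin n → ℝ) (hT₁ : ∀ i j k, T i j k = T j i k) :
    ∑ i, ∑ j, ∑ q, R j q * ∑ k, T i j k * T i q k =
      ∑ k, ∑ r, R k r * ricT T k r := by
  unfold ricT
  simp only [Finset.mul_sum]
  simp only [← Fintype.sum_prod_type']
  refine Finset.sum_nbij' (fun t => (t.2.1, t.2.2.1, t.1, t.2.2.2))
    (fun t => (t.2.2.1, t.1, t.2.1, t.2.2.2))
    (fun _ _ => Finset.mem_univ _) (fun _ _ => Finset.mem_univ _) (fun _ _ => rfl)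
    (fun _ _ => rfl) ?_
  rintro ⟨i, j, q, k⟩ -
  simp only [hT₁]

lemma sum_sq_reorder (Q : Fin n → Fin n → Fin n → Fin n → ℝ) :
    ∑ i, ∑ j, ∑ k, ∑ a, Q a i j k * Q a i j k =
      ∑ a, ∑ i, ∑ j, ∑ k, Q a i j k * Q a i j k := by
  simp only [← Fintype.sum_prod_type']
  refine Finset.sum_nbij' (fun t => (t.2.2.2, t.1, t.2.1, t.2.2.1))
    (fun t => (t.2.1, t.2.2.1, t.2.2.2, t.1))
    (fun _ _ => Finset.mem_univ _) (fun _ _ => Finset.mem_univ _) (fun _ _ => rfl)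
    (fun _ _ => rfl) ?_
  rintro ⟨i, j, k, a⟩ -
  rfl

lemma sum4_swap_mid (F : Fin n → Fin n → Fin n → Fin n → ℝ) :
    ∑ l, ∑ i, ∑ j, ∑ k, F l j i k =
      ∑ l, ∑ i, ∑ j, ∑ k, F l i j k := by
  simp only [← Fintype.sum_prod_type']
  refine Finset.sum_nbij' (fun t => (t.1, t.2.2.1, t.2.1, t.2.2.2))
    (fun t => (t.1, t.2.2.1, t.2.1, t.2.2.2))
    (fun _ _ => Finset.mem_univ _) (fun _ _ => Finset.mem_univ _) (fun _ _ => rfl)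
    (fun _ _ => rfl) ?_
  rintro ⟨l, i, j, k⟩ -
  rfl

lemma sum4_rotate (F : Fin n → Fin n → Fin n → Fin n → ℝ) :
    ∑ l, ∑ i, ∑ j, ∑ k, F l k i j =
      ∑ l, ∑ i, ∑ j, ∑ k, F l i j k := by
  simp only [← Fintype.sum_prod_type']
  refine Finset.sum_nbij' (fun t => (t.1, t.2.2.2, t.2.1, t.2.2.1))
    (fun t => (t.1, t.2.2.1, t.2.2.2, t.2.1))
    (fun _ _ => Finset.mem_univ _) (fun _ _ => Finset.mem_univ _) (fun _ _ => rfl)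
    (fun _ _ => rfl) ?_
  rintro ⟨l, i, j, k⟩ -
  rfl
lemma sum_pairT_sq (hT₁ : ∀ i j k, T i j k = T j i k) (hT₂ : ∀ i j k, T i j k = T i k j) :
    ∑ l, ∑ i, ∑ j, ∑ k, pairT T l i j k * pairT T l i j k =
      ∑ i, ∑ p, ricT T i p * ricT T i p := by
  simp only [pairT, ricT, Finset.sum_mul_sum]
  simp only [← Fintype.sum_prod_type']
  refine Finset.sum_nbij' (fun t => (t.2.2.2.2.1, t.2.2.2.2.2, t.1, t.2.2.1, t.2.1, t.2.2.2.1))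
    (fun t => (t.2.2.1, t.2.2.2.2.1, t.2.2.2.1, t.2.2.2.2.2, t.1, t.2.1))
    (fun _ _ => Finset.mem_univ _) (fun _ _ => Finset.mem_univ _) (fun _ _ => rfl)
    (fun _ _ => rfl) ?_
  rintro ⟨l, i, j, k, p, r⟩ -
  simp only [hT₁, hT₂]
  ring

lemma sum_pairT_mul_swap :
    ∑ l, ∑ i, ∑ j, ∑ k, pairT T l i j k * pairT T l j i k = tetraT T := by
  simp only [pairT, tetraT, Finset.sum_mul_sum]

lemma sum_mul_pairT : ∑ l, ∑ i, ∑ j, ∑ k, Q l i j k * pairT T l i j k = mixQT Q T := by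
  simp only [pairT, mixQT, Finset.mul_sum]

lemma pairT_symm (hT₁ : ∀ i j k, T i j k = T j i k) (l i j k : Fin n) :
    pairT T l i j k = pairT T l i k j := by
  simp only [pairT, hT₁ j k]

lemma sum_pairT_mul_rotate (hT₁ : ∀ i j k, T i j k = T j i k) :
    ∑ l, ∑ i, ∑ j, ∑ k, pairT T l i j k * pairT T l k i j = tetraT T := by
  rw [← sum_pairT_mul_swap]
  refine Finset.sum_congr rfl fun l _ => Finset.sum_congr rfl fun i _ => ?_
  rw [Finset.sum_comm]
  refine Finset.sum_congr rfl fun j _ => Finset.sum_congr rfl fun k _ => ?_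
  rw [pairT_symm hT₁ l i k j]

lemma sum_pairT_swap_mul_rotate (hT₁ : ∀ i j k, T i j k = T j i k) :
    ∑ l, ∑ i, ∑ j, ∑ k, pairT T l j i k * pairT T l k i j = tetraT T := by
  rw [← sum_pairT_mul_swap, ← sum4_rotate fun l i j k => pairT T l j i k * pairT T l k i j]
  refine Finset.sum_congr rfl fun l _ => Finset.sum_congr rfl fun i _ =>
    Finset.sum_congr rfl fun j _ => Finset.sum_congr rfl fun k _ => ?_
  rw [pairT_symm hT₁ l i k j, pairT_symm hT₁ l j k i]

/-- Completing the square: `∑ (Q - W/2)² ≥ 0` for the symmetrization `W` of `pairT`. -/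
lemma square_nonneg_expand (hT₁ : ∀ i j k, T i j k = T j i k) (hT₂ : ∀ i j k, T i j k = T i k j)
    (hQ₂ : ∀ a i j k, Q a i j k = Q a j i k) (hQ₃ : ∀ a i j k, Q a i j k = Q a i k j) :
    0 ≤ ∑ l, ∑ i, ∑ j, ∑ k, Q l i j k * Q l i j k - 3 * mixQT Q T
      + 3 / 4 * ∑ i, ∑ p, ricT T i p * ricT T i p + 3 / 2 * tetraT T := by
  have h₀ : 0 ≤ ∑ l, ∑ i, ∑ j, ∑ k, (Q l i j k
      - 1 / 2 * (pairT T l i j k + pairT T l j i k + pairT T l k i j)) ^ 2 :=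
    Finset.sum_nonneg fun _ _ => Finset.sum_nonneg fun _ _ => Finset.sum_nonneg fun _ _ =>
      Finset.sum_nonneg fun _ _ => sq_nonneg _
  have h₁ := sum4_swap_mid fun l i j k => pairT T l i j k * pairT T l i j k
  have h₂ := sum4_rotate fun l i j k => pairT T l i j k * pairT T l i j k
  have h₃ := sum4_swap_mid fun l i j k => Q l i j k * pairT T l i j k
  have h₄ := sum4_rotate fun l i j k => Q l i j k * pairT T l i j k
  have h₅ : ∀ l i j k, Q l j i k * pairT T l j i k = Q l i j k * pairT T l j i k :=
    fun l i j k => by rw [hQ₂ l j i k]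
  have h₆ : ∀ l i j k, Q l k i j * pairT T l k i j = Q l i j k * pairT T l k i j :=
    fun l i j k => by rw [hQ₂ l k i j, hQ₃ l i k j]
  simp only [h₅] at h₃
  simp only [h₆] at h₄
  rw [sum_pairT_sq hT₁ hT₂] at h₁ h₂
  rw [sum_mul_pairT] at h₃ h₄
  have h₇ := sum_pairT_sq hT₁ hT₂
  have h₈ := sum_pairT_mul_swap (T := T)
  have h₉ := sum_pairT_mul_rotate hT₁
  have h₁₀ := sum_pairT_swap_mul_rotate hT₁
  have h₁₁ := sum_mul_pairT (T := T) (Q := Q)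
  have key : ∀ q a b c : ℝ, (q - 1 / 2 * (a + b + c)) ^ 2 = q * q - (q * a + q * b + q * c)
      + 1 / 4 * (a * a + b * b + c * c) + 1 / 2 * (a * b + a * c + b * c) := by
    intros; ring
  simp only [key, Finset.sum_add_distrib, Finset.sum_sub_distrib, ← Finset.mul_sum] at h₀
  linarith

lemma tetraT_le (hT₁ : ∀ i j k, T i j k = T j i k) (hT₂ : ∀ i j k, T i j k = T i k j) :
    tetraT T ≤ ∑ i, ∑ p, ricT T i p * ricT T i p := by
  have h₀ : 0 ≤ ∑ l, ∑ i, ∑ j, ∑ k, (pairT T l i j k - pairT T l j i k) ^ 2 :=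
    Finset.sum_nonneg fun _ _ => Finset.sum_nonneg fun _ _ => Finset.sum_nonneg fun _ _ =>
      Finset.sum_nonneg fun _ _ => sq_nonneg _
  have h₁ := sum4_swap_mid fun l i j k => pairT T l i j k * pairT T l i j k
  have h₇ := sum_pairT_sq hT₁ hT₂
  have h₈ := sum_pairT_mul_swap (T := T)
  have key : ∀ a b : ℝ, (a - b) ^ 2 = a * a + b * b - 2 * (a * b) := by intros; ring
  simp only [key, Finset.sum_add_distrib, Finset.sum_sub_distrib, ← Finset.mul_sum] at h₀
  linarith

lemma sum_ricT_diag_sq_le :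
    (∑ i, ricT T i i) ^ 2 ≤ n * ∑ i, ∑ p, ricT T i p * ricT T i p := by
  have h := sq_sum_le_card_mul_sum_sq (s := Finset.univ) (f := fun i => ricT T i i)
  rw [Finset.card_univ, Fintype.card_fin] at h
  refine h.trans (mul_le_mul_of_nonneg_left (Finset.sum_le_sum fun i _ => ?_) (Nat.cast_nonneg n))
  rw [sq]
  exact Finset.single_le_sum (f := fun p => ricT T i p * ricT T i p)
    (fun p _ => mul_self_nonneg _) (Finset.mem_univ i)

lemma sum_mul_deriv2T (hT₁ : ∀ i j k, T i j k = T j i k) (hT₂ : ∀ i j k, T i j k = T i k j) :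
    ∑ a, ∑ i, ∑ p, T a i p * deriv2T T Q a i p = 2 * mixQT Q T - 2 * tetraT T := by
  simp only [deriv2T, deriv1T, mul_sub, mul_add, Finset.sum_add_distrib, Finset.sum_sub_distrib,
    mixQT_eq_deriv2_fst hT₁ hT₂, mixQT_eq_deriv2_snd hT₁ hT₂, tetraT_eq_deriv2_fst hT₁ hT₂,
    tetraT_eq_deriv2_snd hT₁ hT₂]
  ring

lemma sum_mul_deriv1T (hT₁ : ∀ i j k, T i j k = T j i k) (hT₂ : ∀ i j k, T i j k = T i k j)
    (hQ₁ : ∀ a i j k, Q a i j k = Q i a j k) (hQ₂ : ∀ a i j k, Q a i j k = Q a j i k) :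
    ∑ i, ∑ a, ∑ j, ∑ q, T a j q * deriv1T T Q a i i j q = 2 * mixQT Q T - tetraT T := by
  simp only [deriv1T, mul_sub, mul_add, Finset.sum_add_distrib, Finset.sum_sub_distrib,
    mixQT_eq_deriv1_fst hT₂ hQ₁ hQ₂, mixQT_eq_deriv1_snd hT₂ hQ₁ hQ₂, tetraT_eq_deriv1 hT₁ hT₂]
  ring

lemma sum_lap1T (P : Fin n → Fin n → Fin n → ℝ)
    (hT₁ : ∀ i j k, T i j k = T j i k) (hT₂ : ∀ i j k, T i j k = T i k j)
    (hQ₁ : ∀ a i j k, Q a i j k = Q i a j k) (hQ₂ : ∀ a i j k, Q a i j k = Q a j i k)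
    (hQ₃ : ∀ a i j k, Q a i j k = Q a i k j) :
    ∑ i, ∑ j, lap1T T Q P i i j j = 2 * ∑ i, ∑ j, ∑ k, T i j k * P i j k
      + 2 * ∑ a, ∑ i, ∑ j, ∑ k, Q a i j k * Q a i j k
      + ∑ i, ∑ p, ricT T i p * ricT T i p - 4 * mixQT Q T := by
  simp only [lap1T, mul_add, Finset.sum_add_distrib, Finset.sum_sub_distrib, ← Finset.mul_sum,
    sum_sq_reorder Q, sum_mul_ricT_left _ hT₁ hT₂, mixQT_eq_lap1_fst hT₂ hQ₁ hQ₂ hQ₃,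
    mixQT_eq_lap1_snd hQ₁ hQ₂ hQ₃]
  ring

lemma sum_mul_cubic {P : Fin n → Fin n → Fin n → ℝ}
    (hT₁ : ∀ i j k, T i j k = T j i k) (hT₂ : ∀ i j k, T i j k = T i k j)
    (hQ₁ : ∀ a i j k, Q a i j k = Q i a j k) (hQ₂ : ∀ a i j k, Q a i j k = Q a j i k)
    (hQ₃ : ∀ a i j k, Q a i j k = Q a i k j)
    (hP : ∀ k l m, P k l m = ∑ i, ∑ j, (Q m l i j * T i j k + T l i j * Q m i j k
      + T m i j * Q l i j k)
      - ∑ i, ∑ j, ∑ s, (T m i s * T l s j + T l i s * T m s j) * T i j k) :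
    ∑ i, ∑ j, ∑ k, T i j k * P i j k = 3 * mixQT Q T - 2 * tetraT T := by
  simp only [hP, mul_sub, mul_add, add_mul, Finset.sum_add_distrib, Finset.sum_sub_distrib,
    mixQT_eq_cubic_fst hT₁ hT₂ hQ₁, mixQT_eq_cubic_snd hT₁ hT₂ hQ₁ hQ₂ hQ₃,
    mixQT_eq_cubic_thd hT₁ hT₂ hQ₁ hQ₂ hQ₃, tetraT_eq_cubic_fst hT₁ hT₂,
    tetraT_eq_cubic_snd hT₁ hT₂]
  ring

lemma lap3T_eq {P : Fin n → Fin n → Fin n → ℝ}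
    (hT₁ : ∀ i j k, T i j k = T j i k) (hT₂ : ∀ i j k, T i j k = T i k j)
    (hQ₁ : ∀ a i j k, Q a i j k = Q i a j k) (hQ₂ : ∀ a i j k, Q a i j k = Q a j i k)
    (hQ₃ : ∀ a i j k, Q a i j k = Q a i k j)
    (hP : ∀ k l m, P k l m = ∑ i, ∑ j, (Q m l i j * T i j k + T l i j * Q m i j k
      + T m i j * Q l i j k)
      - ∑ i, ∑ j, ∑ s, (T m i s * T l s j + T l i s * T m s j) * T i j k) :
    lap3T T Q P = 2 * ∑ a, ∑ i, ∑ j, ∑ k, Q a i j k * Q a i j k - 6 * mixQT Q T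
      + 3 * ∑ i, ∑ p, ricT T i p * ricT T i p + 2 * tetraT T := by
  simp only [lap3T, lap2T, Finset.sum_add_distrib, Finset.sum_sub_distrib, ← Finset.mul_sum,
    sum_lap1T P hT₁ hT₂ hQ₁ hQ₂ hQ₃, sum_mul_ricT_mid _ hT₁, sum_mul_deriv1T hT₁ hT₂ hQ₁ hQ₂,
    sum_mul_deriv2T hT₁ hT₂, sum_mul_cubic hT₁ hT₂ hQ₁ hQ₂ hQ₃ hP]
  ring

lemma le_lap3T {P : Fin n → Fin n → Fin n → ℝ} (hn : 1 ≤ n)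
    (hT₁ : ∀ i j k, T i j k = T j i k) (hT₂ : ∀ i j k, T i j k = T i k j)
    (hQ₁ : ∀ a i j k, Q a i j k = Q i a j k) (hQ₂ : ∀ a i j k, Q a i j k = Q a j i k)
    (hQ₃ : ∀ a i j k, Q a i j k = Q a i k j)
    (hP : ∀ k l m, P k l m = ∑ i, ∑ j, (Q m l i j * T i j k + T l i j * Q m i j k
      + T m i j * Q l i j k)
      - ∑ i, ∑ j, ∑ s, (T m i s * T l s j + T l i s * T m s j) * T i j k) :
    1 / (2 * (n : ℝ)) * (∑ i, ricT T i i) ^ 2 ≤ lap3T T Q P := by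
  have hn' : (0 : ℝ) < n := by exact_mod_cast hn
  have h₁ := square_nonneg_expand hT₁ hT₂ hQ₂ hQ₃
  have h₂ := tetraT_le hT₁ hT₂
  have h₃ := sum_ricT_diag_sq_le (T := T)
  have h₄ : 1 / (2 * (n : ℝ)) * (∑ i, ricT T i i) ^ 2
      ≤ 1 / 2 * ∑ i, ∑ p, ricT T i p * ricT T i p := by
    rw [one_div_mul_eq_div, div_le_iff₀ (by positivity)]
    linarith
  rw [lap3T_eq hT₁ hT₂ hQ₁ hQ₂ hQ₃ hP]
  linarith

end Algebra

section Norm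

variable {N : Set (Fin n → ℝ)} {u : (Fin n → ℝ) → ℝ} {x : Fin n → ℝ}
  {e : Matrix (Fin n) (Fin n) ℝ} {ξ : Fin n → ℝ} {K : (Fin n → ℝ) → ℝ}

/-- The contraction `g^{kr} T_{ijk} T_{pqr}` in a constant frame. -/
def frameContr₁ (u : (Fin n → ℝ) → ℝ) (e : Matrix (Fin n) (Fin n) ℝ) (i p j q : Fin n) :
    (Fin n → ℝ) → ℝ :=
  fun y => ∑ k, ∑ r, (frameHessian u e y)⁻¹ k r * (frameT u e i j k y * frameT u e p q r y)

/-- The contraction `g^{jq} g^{kr} T_{ijk} T_{pqr}` in a constant frame. -/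
def frameContr₂ (u : (Fin n → ℝ) → ℝ) (e : Matrix (Fin n) (Fin n) ℝ) (i p : Fin n) :
    (Fin n → ℝ) → ℝ :=
  fun y => ∑ j, ∑ q, (frameHessian u e y)⁻¹ j q * frameContr₁ u e i p j q y

/-- The contraction `g^{ip} g^{jq} g^{kr} T_{ijk} T_{pqr}` in a constant frame. -/
def frameContr₃ (u : (Fin n → ℝ) → ℝ) (e : Matrix (Fin n) (Fin n) ℝ) : (Fin n → ℝ) → ℝ :=
  fun y => ∑ i, ∑ p, (frameHessian u e y)⁻¹ i p * frameContr₂ u e i p y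

lemma frameInv_smooth (hN : IsOpen N) (hu : Smooth N u)
    (hdet : ∀ y ∈ N, (frameHessian u e y).det ≠ 0) (i p : Fin n) :
    Smooth N fun y => (frameHessian u e y)⁻¹ i p :=
  smooth_inv (frameHessian_smooth hN hu) hdet i p

lemma frameContr₁_smooth (hN : IsOpen N) (hu : Smooth N u)
    (hdet : ∀ y ∈ N, (frameHessian u e y).det ≠ 0) (i p j q : Fin n) :
    Smooth N (frameContr₁ u e i p j q) :=
  ContDiffOn.sum fun k _ => ContDiffOn.sum fun r _ => (frameInv_smooth hN hu hdet k r).mul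
    ((frameT_smooth hN hu i j k).mul (frameT_smooth hN hu p q r))

lemma frameContr₂_smooth (hN : IsOpen N) (hu : Smooth N u)
    (hdet : ∀ y ∈ N, (frameHessian u e y).det ≠ 0) (i p : Fin n) :
    Smooth N (frameContr₂ u e i p) :=
  ContDiffOn.sum fun j _ => ContDiffOn.sum fun q _ => (frameInv_smooth hN hu hdet j q).mul
    (frameContr₁_smooth hN hu hdet i p j q)

lemma frameContr₃_smooth (hN : IsOpen N) (hu : Smooth N u)
    (hdet : ∀ y ∈ N, (frameHessian u e y).det ≠ 0) : Smooth N (frameContr₃ u e) :=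
  ContDiffOn.sum fun i _ => ContDiffOn.sum fun p _ => (frameInv_smooth hN hu hdet i p).mul
    (frameContr₂_smooth hN hu hdet i p)

lemma frameContr₁_value (h1 : frameHessian u e x = 1) (i p j q : Fin n) :
    frameContr₁ u e i p j q x = ∑ k, frameT u e i j k x * frameT u e p q k x :=
  trace_value (h := fun y => (frameHessian u e y)⁻¹)
    (W := fun k r y => frameT u e i j k y * frameT u e p q r y) (by simp [h1])

lemma frameContr₂_value (h1 : frameHessian u e x = 1) (i p : Fin n) :
    frameContr₂ u e i p x = ricT (fun i j k => frameT u e i j k x) i p := by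
  refine (trace_value (h := fun y => (frameHessian u e y)⁻¹)
    (W := fun j q => frameContr₁ u e i p j q) (by simp [h1])).trans ?_
  simp only [frameContr₁_value h1, ricT]

lemma frameContr₃_value (h1 : frameHessian u e x = 1) :
    frameContr₃ u e x = ∑ i, ricT (fun i j k => frameT u e i j k x) i i := by
  refine (trace_value (h := fun y => (frameHessian u e y)⁻¹)
    (W := fun i p => frameContr₂ u e i p) (by simp [h1])).trans ?_
  simp only [frameContr₂_value h1]

lemma dd_frameContr₁ (hN : IsOpen N) (hu : Smooth N u)
    (hdet : ∀ y ∈ N, (frameHessian u e y).det ≠ 0) (hx : x ∈ N) (h1 : frameHessian u e x = 1)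
    (a i p j q : Fin n) :
    dd (e a) (frameContr₁ u e i p j q) x =
      deriv1T (fun i j k => frameT u e i j k x) (fun a i j k => frameQ u e a i j k x) a i p j q := by
  refine (dd_trace hN (h := fun y => (frameHessian u e y)⁻¹)
    (W := fun k r y => frameT u e i j k y * frameT u e p q r y) (frameInv_smooth hN hu hdet)
    (fun k r => (frameT_smooth hN hu i j k).mul (frameT_smooth hN hu p q r)) hx
    (by simp [h1]) (e a)).trans ?_
  simp only [dd_frame_inv_eq hN hu hdet hx h1,
    dd_mul hN (frameT_smooth hN hu _ _ _) (frameT_smooth hN hu _ _ _) hx, deriv1T, neg_mul,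
    Finset.sum_neg_distrib]
  rfl

lemma dd_frameContr₂ (hN : IsOpen N) (hu : Smooth N u)
    (hdet : ∀ y ∈ N, (frameHessian u e y).det ≠ 0) (hx : x ∈ N) (h1 : frameHessian u e x = 1)
    (a i p : Fin n) :
    dd (e a) (frameContr₂ u e i p) x =
      deriv2T (fun i j k => frameT u e i j k x) (fun a i j k => frameQ u e a i j k x) a i p := by
  refine (dd_trace hN (h := fun y => (frameHessian u e y)⁻¹)
    (W := fun j q => frameContr₁ u e i p j q) (frameInv_smooth hN hu hdet)
    (fun j q => frameContr₁_smooth hN hu hdet i p j q) hx (by simp [h1]) (e a)).trans ?_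
  simp only [dd_frame_inv_eq hN hu hdet hx h1, dd_frameContr₁ hN hu hdet hx h1,
    frameContr₁_value h1, deriv2T, neg_mul, Finset.sum_neg_distrib]
  rfl

lemma frameOp_frameContr₁ (hN : IsOpen N) (hu : Smooth N u)
    (hdet : ∀ y ∈ N, (frameHessian u e y).det ≠ 0)
    (hE : ∀ y ∈ N, ∀ w, ∑ a, ∑ b, (frameHessian u e y)⁻¹ a b * dd (e a) (dd (e b) (dd w u)) y =
      K w + dd w (dd ξ u) y) (hx : x ∈ N) (h1 : frameHessian u e x = 1) (i p j q : Fin n) :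
    frameOp e ξ (frameContr₁ u e i p j q) x =
      lap1T (fun i j k => frameT u e i j k x) (fun a i j k => frameQ u e a i j k x)
        (fun i j k => frameOp e ξ (frameT u e i j k) x) i p j q := by
  refine (frameOp_trace hN (h := fun y => (frameHessian u e y)⁻¹)
    (W := fun k r y => frameT u e i j k y * frameT u e p q r y) (frameInv_smooth hN hu hdet)
    (fun k r => (frameT_smooth hN hu i j k).mul (frameT_smooth hN hu p q r)) hx
    (by simp [h1]) e ξ).trans ?_
  simp only [dd_frame_inv_eq hN hu hdet hx h1, frameOp_frame_inv hN hu hdet hE hx h1,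
    dd_mul hN (frameT_smooth hN hu _ _ _) (frameT_smooth hN hu _ _ _) hx,
    frameOp_mul hN (frameT_smooth hN hu _ _ _) (frameT_smooth hN hu _ _ _) hx, lap1T, ricT,
    neg_mul, Finset.sum_neg_distrib, mul_neg, ← sub_eq_add_neg]
  rfl

lemma frameOp_frameContr₂ (hN : IsOpen N) (hu : Smooth N u)
    (hdet : ∀ y ∈ N, (frameHessian u e y).det ≠ 0)
    (hE : ∀ y ∈ N, ∀ w, ∑ a, ∑ b, (frameHessian u e y)⁻¹ a b * dd (e a) (dd (e b) (dd w u)) y =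
      K w + dd w (dd ξ u) y) (hx : x ∈ N) (h1 : frameHessian u e x = 1) (i p : Fin n) :
    frameOp e ξ (frameContr₂ u e i p) x =
      lap2T (fun i j k => frameT u e i j k x) (fun a i j k => frameQ u e a i j k x)
        (fun i j k => frameOp e ξ (frameT u e i j k) x) i p := by
  refine (frameOp_trace hN (h := fun y => (frameHessian u e y)⁻¹)
    (W := fun j q => frameContr₁ u e i p j q) (frameInv_smooth hN hu hdet)
    (fun j q => frameContr₁_smooth hN hu hdet i p j q) hx (by simp [h1]) e ξ).trans ?_
  simp only [dd_frame_inv_eq hN hu hdet hx h1, frameOp_frame_inv hN hu hdet hE hx h1,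
    dd_frameContr₁ hN hu hdet hx h1, frameOp_frameContr₁ hN hu hdet hE hx h1,
    frameContr₁_value h1, lap2T, ricT, neg_mul, Finset.sum_neg_distrib, mul_neg,
    ← sub_eq_add_neg]

lemma frameOp_frameContr₃ (hN : IsOpen N) (hu : Smooth N u)
    (hdet : ∀ y ∈ N, (frameHessian u e y).det ≠ 0)
    (hE : ∀ y ∈ N, ∀ w, ∑ a, ∑ b, (frameHessian u e y)⁻¹ a b * dd (e a) (dd (e b) (dd w u)) y =
      K w + dd w (dd ξ u) y) (hx : x ∈ N) (h1 : frameHessian u e x = 1) :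
    frameOp e ξ (frameContr₃ u e) x =
      lap3T (fun i j k => frameT u e i j k x) (fun a i j k => frameQ u e a i j k x)
        (fun i j k => frameOp e ξ (frameT u e i j k) x) := by
  refine (frameOp_trace hN (h := fun y => (frameHessian u e y)⁻¹)
    (W := fun i p => frameContr₂ u e i p) (frameInv_smooth hN hu hdet)
    (fun i p => frameContr₂_smooth hN hu hdet i p) hx (by simp [h1]) e ξ).trans ?_
  simp only [dd_frame_inv_eq hN hu hdet hx h1, frameOp_frame_inv hN hu hdet hE hx h1,
    dd_frameContr₂ hN hu hdet hx h1, frameOp_frameContr₂ hN hu hdet hE hx h1,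
    frameContr₂_value h1, lap3T, ricT, neg_mul, Finset.sum_neg_distrib, mul_neg,
    ← sub_eq_add_neg]

/-- A positive definite matrix is congruent to the identity. -/
lemma exists_frame {A : Matrix (Fin n) (Fin n) ℝ} (hA : A.PosDef) :
    ∃ e : Matrix (Fin n) (Fin n) ℝ, IsUnit e.det ∧ e * A * e.transpose = 1 := by
  open scoped MatrixOrder in
  obtain ⟨B, hB⟩ := CStarAlgebra.nonneg_iff_eq_star_mul_self.mp hA.posSemidef.nonneg
  rw [Matrix.star_eq_conjTranspose, Matrix.conjTranspose_eq_transpose_of_trivial] at hB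
  have hdet : IsUnit B.det := by
    have h := hA.det_pos.ne'
    rw [hB, Matrix.det_mul] at h
    exact isUnit_iff_ne_zero.mpr (right_ne_zero_of_mul h)
  refine ⟨(B⁻¹).transpose, ?_, ?_⟩
  · rw [Matrix.det_transpose]
    exact Matrix.isUnit_nonsing_inv_det B hdet
  · rw [hB, Matrix.transpose_transpose, ← Matrix.mul_assoc, ← Matrix.transpose_mul,
      Matrix.mul_nonsing_inv B hdet, Matrix.transpose_one, Matrix.one_mul,
      Matrix.mul_nonsing_inv B hdet]

end Norm

lemma norm3_eqOn_frameContr₃ {N : Set (Fin n → ℝ)} {u : (Fin n → ℝ) → ℝ}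
    {e : Matrix (Fin n) (Fin n) ℝ} (hN : IsOpen N) (hu : Smooth N u) (he : IsUnit e.det) :
    Set.EqOn (norm3 u) (frameContr₃ u e) N := fun y hy => by
  rw [norm3_eq_frame hN hu hy he, contract3_eq_nested]
  rfl

theorem calabi_differential_inequality {n : ℕ} (hn : 1 ≤ n) (N : Set (Fin n → ℝ)) (hNopen : IsOpen N)
    (hNne : N.Nonempty) (u : (Fin n → ℝ) → ℝ) (hu : ContDiffOn ℝ (⊤ : ℕ∞) u N)
    (hpos : ∀ x ∈ N, (hessian u x).PosDef)
    (v ξ : Fin n → ℝ) (c : ℝ) (hMA : MAeq u N v ξ c) :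
    ∀ x ∈ N,
      driftLap u (weight u ξ v) (norm3 u) x ≥ (1/(2*(n : ℝ))) * (norm3 u x)^2 := by
  intro x hx
  obtain ⟨e, he, h1⟩ := exists_frame (hpos x hx)
  rw [← frameHessian_eq hNopen hu hx] at h1
  have hdet : ∀ y ∈ N, (frameHessian u e y).det ≠ 0 := fun y hy => by
    rw [frameHessian_eq hNopen hu hy, Matrix.det_mul, Matrix.det_mul, Matrix.det_transpose]
    exact mul_ne_zero (mul_ne_zero he.ne_zero (hpos y hy).det_pos.ne') he.ne_zero
  have hE : ∀ y ∈ N, ∀ w, ∑ a, ∑ b, (frameHessian u e y)⁻¹ a b *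
      dd (e a) (dd (e b) (dd w u)) y = -(∑ p, v p * w p) + dd w (dd ξ u) y := fun y hy w => by
    rw [← contract_frame hNopen hu (Smooth.dd hu hNopen w) hy he, hMA.dd_eq hNopen hu hpos hy]
  have hnorm := norm3_eqOn_frameContr₃ hNopen hu he
  have hL : driftLap u (weight u ξ v) (norm3 u) x = frameOp e ξ (norm3 u) x := by
    rw [driftLap_weight_eq hMA hNopen hu hpos hx, contract_frame hNopen hu
      ((frameContr₃_smooth hNopen hu hdet).congr hnorm) hx he, h1, frameOp]
    simp [Matrix.one_apply]
  rw [ge_iff_le, hL, frameOp_congr hNopen hnorm hx, hnorm hx,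
    frameOp_frameContr₃ (K := fun w => -(∑ p, v p * w p)) hNopen hu hdet hE hx h1,
    frameContr₃_value h1]
  exact le_lap3T hn (fun _ _ _ => frameT_symm_left hNopen hu hx _ _ _)
    (fun _ _ _ => frameT_symm_right hNopen hu hx _ _ _)
    (fun _ _ _ _ => frameQ_symm_left hNopen hu hx _ _ _ _)
    (fun _ _ _ _ => frameQ_symm_mid hNopen hu hx _ _ _ _)
    (fun _ _ _ _ => frameQ_symm_right hNopen hu hx _ _ _ _)
    (fun _ _ _ => frameOp_frameT (K := fun w => -(∑ p, v p * w p)) hNopen hu hdet hE hx h1 _ _ _)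

end KRS
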